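/- arXiv:2106.01875 — 8 statements merged into one kernel-verified Lean document; each statement's English description precedes it below -/
import Mathlib

section
/- Fix an integer k ≥ 3, an integer d ≥ 1, and reals τ ∈ (2,3), γ > 1 with k > 2/(3−τ). Then for every feasible (α,β) (i.e. α_i ≥ 0 for all 1 ≤ i ≤ k and β_i^{(h)} ≤ 0 for all 2 ≤ i ≤ k, 1 ≤ h ≤ d) one has f(α,β) ≤ k(3−τ)/2, and equality holds for α* = (1/2,...,1/2) and β*_i^{(h)} = 0 for all i ≥ 2 and h; hence the maximum of f over the feasible region equals k(3−τ)/2 and is attained at (α*,β*). -/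
open MeasureTheory Real Finset
open scoped ENNReal Topology

/-- The clique exponent function `f(α,β)` from the paper, with the convention that for
pairs with `i = 1` (here `i = 0`) the inner maximum over coordinates equals `max_h β_j^{(h)}`. -/
noncomputable def cliqueExponent (k d : ℕ) (τ γ : ℝ)
    (α : Fin k → ℝ) (β : Fin k → Fin d → ℝ) : ℝ :=
  k + (1 - τ) * ∑ i, α i
    + ∑ i ∈ Finset.univ.filter (fun i : Fin k => (i : ℕ) ≠ 0), ∑ h, β i h
    + ∑ i : Fin k, ∑ j ∈ Finset.Ioi i,
        γ * min (α i + α j - 1 -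
          d * (if (i : ℕ) = 0 then ⨆ h, β j h else ⨆ h, max (β i h) (β j h))) 0

lemma pair_sum_aux (k : ℕ) (g : Fin k → ℝ) :
    ∑ i : Fin k, ∑ j ∈ Finset.Ioi i, (g i + g j) = ((k : ℝ) - 1) * ∑ i, g i := by
  simp only [Finset.sum_add_distrib]
  have h2 : ∑ i : Fin k, ∑ j ∈ Finset.Ioi i, g j = ∑ j : Fin k, ∑ i ∈ Finset.Iio j, g j :=
    Finset.sum_comm' (by intro x y; simp)
  rw [h2, ← Finset.sum_add_distrib, Finset.mul_sum]
  refine Finset.sum_congr rfl fun i _ => ?_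
  simp only [Finset.sum_const, Fin.card_Ioi, Fin.card_Iio, nsmul_eq_mul]
  have hi := i.2
  have : ((k - 1 - (i : ℕ) : ℕ) : ℝ) + ((i : ℕ) : ℝ) = (k : ℝ) - 1 := by
    rw [← Nat.cast_add, Nat.sub_add_cancel (by omega), Nat.cast_sub (by omega)]
    simp
  rw [← this]
  ring

lemma min_aux (γ c t u : ℝ) (hc : 0 ≤ c) (hcγ : c ≤ γ) (h : t ≤ u) :
    γ * min t 0 ≤ c * u := by
  have h1 : min t 0 ≤ 0 := min_le_right _ _
  have h2 : min t 0 ≤ u := (min_le_left _ _).trans h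
  nlinarith

/-- In the non-geometric regime `k > 2/(3-τ)`, the clique exponent `f` is at most
`k(3-τ)/2` on the feasible region, with equality at `α* = (1/2,...,1/2)`, `β* = 0`. -/
theorem maximum_of_clique_exponent_nongeometric (k d : ℕ) (hk : 3 ≤ k) (hd : 1 ≤ d)
    (τ γ : ℝ) (hτ : 2 < τ) (hτ' : τ < 3) (hγ : 1 < γ)
    (hkτ : (k : ℝ) > 2 / (3 - τ)) :
    (∀ (α : Fin k → ℝ) (β : Fin k → Fin d → ℝ),
        (∀ i, 0 ≤ α i) → (∀ i : Fin k, (i : ℕ) ≠ 0 → ∀ h, β i h ≤ 0) →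
        cliqueExponent k d τ γ α β ≤ (k : ℝ) * (3 - τ) / 2)
    ∧ cliqueExponent k d τ γ (fun _ => 1 / 2) (fun _ _ => 0)
        = (k : ℝ) * (3 - τ) / 2 := by
  have hk' : (3 : ℝ) ≤ k := by exact_mod_cast hk
  have hd' : (0 : ℝ) ≤ d := by positivity
  have hkτ2 : 2 < (k : ℝ) * (3 - τ) := by
    have := (div_lt_iff₀ (by linarith : (0 : ℝ) < 3 - τ)).1 hkτ
    linarith
  have : Nonempty (Fin d) := ⟨⟨0, hd⟩⟩
  constructor
  · intro α β hα hβ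
    have bdd : ∀ g : Fin d → ℝ, BddAbove (Set.range g) := fun g => (Set.finite_range g).bddAbove
    obtain ⟨x, hx⟩ : ∃ x : Fin k → ℝ,
        x = fun i : Fin k => if (i : ℕ) = 0 then 0 else -(d * ⨆ h, β i h) := ⟨_, rfl⟩
    have hx0 : ∀ i : Fin k, (i : ℕ) = 0 → x i = 0 := by intro i hi; simp [hx, hi]
    have hx1 : ∀ i : Fin k, (i : ℕ) ≠ 0 → x i = -(d * ⨆ h, β i h) := by
      intro i hi; simp [hx, hi]
    have hxn : ∀ i, 0 ≤ x i := by
      intro i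
      by_cases hi : (i : ℕ) = 0
      · rw [hx0 i hi]
      · rw [hx1 i hi]
        have : ⨆ h, β i h ≤ 0 := ciSup_le (hβ i hi)
        nlinarith
    have hX : ∑ i ∈ Finset.univ.filter (fun i : Fin k => (i : ℕ) ≠ 0), ∑ h, β i h
        ≤ - ∑ i, x i := by
      rw [Finset.sum_filter, ← Finset.sum_neg_distrib]
      refine Finset.sum_le_sum fun i _ => ?_
      by_cases hi : (i : ℕ) = 0
      · simp [hi, hx0 i hi]
      · rw [if_pos hi, hx1 i hi, neg_neg]
        calc ∑ h, β i h ≤ ∑ _h : Fin d, ⨆ h, β i h :=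
              Finset.sum_le_sum fun h _ => le_ciSup (bdd (β i)) h
          _ = d * ⨆ h, β i h := by simp
    obtain ⟨c, hc⟩ : ∃ c : ℝ, c = (τ - 1) / (k - 1) := ⟨_, rfl⟩
    have hck : c * (k - 1) = τ - 1 := by
      rw [hc]; exact div_mul_cancel₀ _ (by linarith)
    have hc0 : 0 ≤ c := by rw [hc]; apply div_nonneg <;> linarith
    have hc1 : c ≤ 1 := by rw [hc, div_le_one (by linarith)]; linarith
    have hD : ∑ i : Fin k, ∑ j ∈ Finset.Ioi i,
        γ * min (α i + α j - 1 -
          d * (if (i : ℕ) = 0 then ⨆ h, β j h else ⨆ h, max (β i h) (β j h))) 0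
        ≤ ∑ i : Fin k, ∑ j ∈ Finset.Ioi i,
          (c * (((α i - 1 / 2 + x i / 2) + (α j - 1 / 2 + x j / 2)))
            + c * (if (i : ℕ) = 0 then x j / 2 else 0)) := by
      refine Finset.sum_le_sum fun i _ => Finset.sum_le_sum fun j hj => ?_
      rw [← mul_add]
      apply min_aux _ _ _ _ hc0 (by linarith)
      have hij : (i : ℕ) < j := by simpa using hj
      have hj0 : (j : ℕ) ≠ 0 := by omega
      by_cases hi : (i : ℕ) = 0
      · rw [if_pos hi, if_pos hi, hx0 i hi, hx1 j hj0]
        linarith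
      · rw [if_neg hi, if_neg hi, hx1 i hi, hx1 j hj0]
        have h1 : ⨆ h, β i h ≤ ⨆ h, max (β i h) (β j h) :=
          ciSup_mono (bdd _) fun h => le_max_left _ _
        have h2 : ⨆ h, β j h ≤ ⨆ h, max (β i h) (β j h) :=
          ciSup_mono (bdd _) fun h => le_max_right _ _
        have h3 := mul_le_mul_of_nonneg_left h1 hd'
        have h4 := mul_le_mul_of_nonneg_left h2 hd'
        linarith
    have hE : ∑ i : Fin k, ∑ j ∈ Finset.Ioi i, (if (i : ℕ) = 0 then x j / 2 else 0)
        ≤ (∑ i, x i) / 2 := by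
      rw [Finset.sum_eq_single (⟨0, by omega⟩ : Fin k)]
      · simp only [if_true]
        rw [Finset.sum_div]
        exact Finset.sum_le_sum_of_subset_of_nonneg (Finset.subset_univ _)
          fun i _ _ => by have := hxn i; positivity
      · intro b _ hb
        have : (b : ℕ) ≠ 0 := fun h => hb (Fin.ext h)
        simp [this]
      · simp
    have hS : ∑ i : Fin k, (α i - 1 / 2 + x i / 2)
        = ∑ i, α i - k / 2 + (∑ i, x i) / 2 := by
      rw [Finset.sum_add_distrib, Finset.sum_sub_distrib, Finset.sum_div]
      simp
      ring
    have hsplit : ∀ F G : Fin k → Fin k → ℝ,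
        ∑ i : Fin k, ∑ j ∈ Finset.Ioi i, (c * F i j + c * G i j)
          = c * ∑ i : Fin k, ∑ j ∈ Finset.Ioi i, F i j
            + c * ∑ i : Fin k, ∑ j ∈ Finset.Ioi i, G i j := by
      intro F G
      simp only [Finset.sum_add_distrib, Finset.mul_sum]
    rw [hsplit (fun i j => (α i - 1 / 2 + x i / 2) + (α j - 1 / 2 + x j / 2))
      (fun i j => if (i : ℕ) = 0 then x j / 2 else 0)] at hD
    rw [pair_sum_aux k (fun i => α i - 1 / 2 + x i / 2), hS, ← mul_assoc, hck] at hD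
    have hXn : 0 ≤ ∑ i, x i := Finset.sum_nonneg fun i _ => hxn i
    unfold cliqueExponent
    generalize ∑ i, x i = X at *
    generalize ∑ i, α i = A at *
    have hE' := mul_le_mul_of_nonneg_left hE hc0
    have hck2 : c * k ≤ 2 := by
      have : c * k * (k - 1) ≤ 2 * (k - 1) := by
        have : c * k * (k - 1) = (τ - 1) * k := by rw [← hck]; ring
        nlinarith
      exact le_of_mul_le_mul_right this (by linarith)
    have hfin : (τ - 1) * X / 2 + c * X / 2 ≤ X := by
      rw [← hck]; nlinarith
    linarith
  · unfold cliqueExponent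
    norm_num
    ring
end

section
/- Fix an integer k ≥ 3, an integer d ≥ 1, and reals τ ∈ (2,3), γ > 1 with k < 2/(3−τ). Then for every feasible (α,β) (i.e. α_i ≥ 0 for all 1 ≤ i ≤ k and β_i^{(h)} ≤ 0 for all 2 ≤ i ≤ k, 1 ≤ h ≤ d) one has f(α,β) ≤ 1, and equality holds for α* = (0,...,0) and β*_i^{(h)} = −1/d for all i ≥ 2 and h; hence the maximum of f over the feasible region equals 1 and is attained at (α*,β*). -/
open MeasureTheory Real Finset
open scoped ENNReal Topology

lemma clique_pair_sum (k : ℕ) (u : Fin k → ℝ) :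
    ∑ i : Fin k, ∑ j ∈ Finset.Ioi i, (u i + u j) = ((k : ℝ) - 1) * ∑ i, u i := by
  have h1 : ∑ i : Fin k, ∑ j ∈ Finset.Ioi i, u j = ∑ j : Fin k, ∑ i ∈ Finset.Iio j, u j := by
    apply Finset.sum_comm'
    intro x y
    simp
  simp only [Finset.sum_add_distrib]
  rw [h1, Finset.mul_sum, ← Finset.sum_add_distrib]
  refine Finset.sum_congr rfl fun i _ => ?_
  rw [Finset.sum_const, Finset.sum_const, Fin.card_Ioi, Fin.card_Iio, nsmul_eq_mul, nsmul_eq_mul,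
    ← add_mul]
  congr 1
  have h := i.2
  have : (k - 1 - (i : ℕ)) + (i : ℕ) + 1 = k := by omega
  have h2 : (((k - 1 - (i : ℕ) : ℕ) : ℝ)) + (i : ℕ) + 1 = k := by exact_mod_cast this
  linarith

lemma clique_sum_le_sup (d : ℕ) (b : Fin d → ℝ) : ∑ h, b h ≤ d * ⨆ h, b h := by
  have : ∑ h, b h ≤ ∑ _h : Fin d, ⨆ h, b h :=
    Finset.sum_le_sum fun h _ => le_ciSup (Set.finite_range b).bddAbove h
  simpa using this

lemma clique_min_le (γ c x y : ℝ) (hc0 : 0 ≤ c) (hcγ : c ≤ γ) (hxy : x ≤ y) :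
    γ * min x 0 ≤ c * y := by
  rcases le_total x 0 with h | h
  · rw [min_eq_left h]; nlinarith
  · rw [min_eq_right h]; nlinarith

/-- In the geometric regime `k < 2/(3-τ)`, the clique exponent `f` is at most `1`
on the feasible region, with equality at `α* = 0`, `β*_i^{(h)} = -1/d`. -/
theorem maximum_of_clique_exponent_geometric (k d : ℕ) (hk : 3 ≤ k) (hd : 1 ≤ d)
    (τ γ : ℝ) (hτ : 2 < τ) (hτ' : τ < 3) (hγ : 1 < γ)
    (hkτ : (k : ℝ) < 2 / (3 - τ)) :
    (∀ (α : Fin k → ℝ) (β : Fin k → Fin d → ℝ),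
        (∀ i, 0 ≤ α i) → (∀ i : Fin k, (i : ℕ) ≠ 0 → ∀ h, β i h ≤ 0) →
        cliqueExponent k d τ γ α β ≤ 1)
    ∧ cliqueExponent k d τ γ (fun _ => 0) (fun _ _ => -(1 / (d : ℝ))) = 1 := by
  obtain ⟨n, rfl⟩ : ∃ n, k = n + 1 := ⟨k - 1, by omega⟩
  have hn : (2 : ℝ) ≤ n := by exact_mod_cast (by omega : 2 ≤ n)
  have hd0 : (d : ℝ) ≠ 0 := by positivity
  constructor
  · intro α β hα _
    set K : ℝ := ((n + 1 : ℕ) : ℝ) with hK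
    have hKn : K = n + 1 := by simp [hK]
    have hK0 : 0 < K := by linarith
    set t : Fin (n + 1) → ℝ := fun i => if (i : ℕ) ≠ 0 then ∑ h, β i h else 0 with ht
    have hT : ∑ i ∈ Finset.univ.filter (fun i : Fin (n + 1) => (i : ℕ) ≠ 0), ∑ h, β i h
        = ∑ i, t i := by
      rw [Finset.sum_filter]
    have hbound : ∑ i : Fin (n + 1), ∑ j ∈ Finset.Ioi i,
        γ * min (α i + α j - 1 -
          d * (if (i : ℕ) = 0 then ⨆ h, β j h else ⨆ h, max (β i h) (β j h))) 0
        ≤ ∑ i : Fin (n + 1), ∑ j ∈ Finset.Ioi i, (2 / K) *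
          (((α i - t i / 2 - 1 / 2) + (α j - t j / 2 - 1 / 2))
            + (if (i : ℕ) = 0 then - t j / 2 else 0)) := by
      refine Finset.sum_le_sum fun i _ => Finset.sum_le_sum fun j hj => ?_
      apply clique_min_le
      · positivity
      · have : 2 / K ≤ 1 := by rw [div_le_one hK0]; linarith
        linarith
      · have hij : i < j := by simpa using hj
        have hj0 : (j : ℕ) ≠ 0 := by
          have : (i : ℕ) < j := hij
          omega
        by_cases hi : (i : ℕ) = 0
        · have := clique_sum_le_sup d (β j)
          simp only [ht, hi, hj0, if_true, ne_eq, not_true, not_false_eq_true, if_false]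
          linarith
        · have h1 := clique_sum_le_sup d (fun h => max (β i h) (β j h))
          have h2 : ∑ h, β i h ≤ ∑ h, max (β i h) (β j h) :=
            Finset.sum_le_sum fun h _ => le_max_left _ _
          have h3 : ∑ h, β j h ≤ ∑ h, max (β i h) (β j h) :=
            Finset.sum_le_sum fun h _ => le_max_right _ _
          simp only [ht, hi, hj0, if_true, ne_eq, not_false_eq_true, if_false]
          linarith
    have hlast : ∑ i : Fin (n + 1), ∑ j ∈ Finset.Ioi i, (if (i : ℕ) = 0 then - t j / 2 else 0)
        = - (∑ i, t i) / 2 := by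
      rw [Finset.sum_eq_single (0 : Fin (n + 1))]
      · rw [Fin.sum_univ_succ]
        have h0 : t 0 = 0 := by simp [ht]
        rw [h0, zero_add, ← Finset.sum_neg_distrib, Finset.sum_div, Fin.Ioi_zero_eq_map,
          Finset.sum_map]
        simp
      · intro i _ hi
        have : (i : ℕ) ≠ 0 := fun h => hi (Fin.ext h)
        simp [this]
      · simp
    have hval : ∑ i : Fin (n + 1), ∑ j ∈ Finset.Ioi i, (2 / K) *
          (((α i - t i / 2 - 1 / 2) + (α j - t j / 2 - 1 / 2))
            + (if (i : ℕ) = 0 then - t j / 2 else 0))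
        = (2 - 2 / K) * ∑ i, α i - ∑ i, t i - (K - 1) := by
      simp only [← Finset.mul_sum]
      simp only [Finset.sum_add_distrib (f := fun j => _ + _)]
      rw [Finset.sum_add_distrib, hlast, clique_pair_sum (n + 1) (fun i => α i - t i / 2 - 1 / 2)]
      simp only [Finset.sum_sub_distrib, ← Finset.sum_div, Finset.sum_const, Finset.card_univ,
        Fintype.card_fin, nsmul_eq_mul]
      rw [← hK]
      field_simp
      ring
    have hA : 0 ≤ ∑ i, α i := Finset.sum_nonneg fun i _ => hα i
    have hc : 3 - τ ≤ 2 / K := by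
      rw [lt_div_iff₀ (by linarith)] at hkτ
      rw [le_div_iff₀ hK0]
      linarith
    unfold cliqueExponent
    rw [hT]
    nlinarith [mul_nonneg (sub_nonneg.2 hc) hA]
  · have : Nonempty (Fin d) := ⟨⟨0, hd⟩⟩
    unfold cliqueExponent
    have hf : (Finset.univ.filter (fun i : Fin (n + 1) => (i : ℕ) ≠ 0)).card = n := by
      have : Finset.univ.filter (fun i : Fin (n + 1) => (i : ℕ) ≠ 0) = Finset.Ioi 0 := by
        ext i
        simp [Fin.pos_iff_ne_zero]
      rw [this, Fin.card_Ioi]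
      simp
    simp only [max_self, ciSup_const, ite_self, Finset.sum_const, hf, nsmul_eq_mul]
    have : (d : ℝ) * -(1 / (d : ℝ)) = -1 := by field_simp
    simp [hd0]
end

section
/- Fix an integer k ≥ 3, an integer d ≥ 1, and reals τ ∈ (2,3), γ > 1. If k > 2/(3−τ), then the integral J^{NG} := ∫_{(0,∞)^k} ∫_{(𝕋^d)^k} (y₁⋯y_k)^{−τ} ∏_{1≤i<j≤k} min{1, (y_i y_j/‖x_i − x_j‖^d)^γ} dx₁⋯dx_k dy₁⋯dy_k is finite. -/
open MeasureTheory Real Finset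
open scoped ENNReal Topology

/-- The connection probability `min{1, (t/r)^γ}`, interpreted as `1` when `r = 0`. -/
noncomputable def edgeProb (γ t r : ℝ) : ℝ := if r = 0 then 1 else min 1 ((t / r) ^ γ)

lemma jng_split {α : Type*} [MeasureSpace α] [SigmaFinite (volume : Measure α)] {n : ℕ}
    (m : Fin (n + 1)) (F : α → (Fin n → α) → ℝ≥0∞) (hF : Measurable (Function.uncurry F)) :
    ∫⁻ x : Fin (n + 1) → α, F (x m) (fun i => x (m.succAbove i)) = ∫⁻ a, ∫⁻ z, F a z := by
  have h := (volume_preserving_piFinSuccAbove (fun _ : Fin (n + 1) => α) m).lintegral_comp hF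
  rw [Measure.volume_eq_prod, lintegral_prod _ hF.aemeasurable] at h
  exact h

lemma jng_prod {α : Type*} [MeasureSpace α] [SigmaFinite (volume : Measure α)] {n : ℕ}
    (f : Fin n → α → ℝ≥0∞) (hf : ∀ i, Measurable (f i)) :
    ∫⁻ x : Fin n → α, ∏ i, f i (x i) = ∏ i, ∫⁻ a, f i a := by
  induction n with
  | zero => simp [volume_pi]
  | succ n ih =>
    simp_rw [Fin.prod_univ_succ]
    have := jng_split (0 : Fin (n+1)) (fun a z => f 0 a * ∏ i : Fin n, f i.succ (z i))
      (by
        unfold Function.uncurry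
        have := fun i => hf i
        fun_prop)
    simp only [Fin.succAbove_zero] at this
    rw [this]
    have h2 := ih (fun i => f i.succ) (fun i => hf _)
    have h3 : ∀ a, ∫⁻ z : Fin n → α, f 0 a * ∏ i : Fin n, f i.succ (z i)
        = f 0 a * ∏ i : Fin n, ∫⁻ b, f i.succ b := by
      intro a
      rw [lintegral_const_mul _ (by have := fun i => hf i; fun_prop), h2]
    simp_rw [h3]
    rw [lintegral_mul_const _ (hf 0)]

lemma jng_star {α : Type*} [MeasureSpace α] [SigmaFinite (volume : Measure α)] {n : ℕ}
    (m : Fin (n + 1)) (f : α → ℝ≥0∞) (hf : Measurable f) (g : Fin n → α → α → ℝ≥0∞)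
    (hg : ∀ i, Measurable (Function.uncurry (g i))) :
    ∫⁻ x : Fin (n + 1) → α, f (x m) * ∏ i, g i (x m) (x (m.succAbove i)) =
      ∫⁻ a, f a * ∏ i, ∫⁻ b, g i a b := by
  rw [jng_split m (fun a z => f a * ∏ i, g i a (z i))]
  · refine lintegral_congr fun a => ?_
    rw [lintegral_const_mul, jng_prod]
    · intro i; exact (hg i).comp (measurable_const.prodMk measurable_id)
    · refine Finset.measurable_fun_prod _ fun i _ => ?_
      exact (hg i).comp (measurable_const.prodMk (measurable_pi_apply i))
  · refine (hf.comp measurable_fst).mul (Finset.measurable_fun_prod _ fun i _ => ?_)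
    exact (hg i).comp (measurable_fst.prodMk ((measurable_pi_apply i).comp measurable_snd))

lemma jng_comb {n : ℕ} (m : Fin (n + 1)) (a : Fin (n + 1) → Fin (n + 1) → ℝ≥0∞)
    (ha : ∀ i j, a i j ≤ 1) (hs : ∀ i j, a i j = a j i) :
    ∏ i, ∏ j ∈ Finset.Ioi i, a i j ≤ ∏ i : Fin n, a m (m.succAbove i) := by
  have h1 : ∀ i, ∏ j ∈ Finset.Ioi i, a i j ≤
      (if i < m then a m i else 1) * (if i = m then ∏ j ∈ Finset.Ioi m, a m j else 1) := by
    intro i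
    rcases lt_trichotomy i m with h | h | h
    · rw [if_pos h, if_neg h.ne, mul_one, hs m i]
      rw [← Finset.mul_prod_erase _ _ (Finset.mem_Ioi.2 h)]
      exact mul_le_of_le_one_right' (Finset.prod_le_one' fun j _ => ha i j)
    · subst h; simp
    · rw [if_neg h.not_gt, if_neg h.ne', mul_one]
      exact Finset.prod_le_one' fun j _ => ha i j
  refine (Finset.prod_le_prod' fun i _ => h1 i).trans ?_
  rw [Finset.prod_mul_distrib, Finset.prod_ite_eq' Finset.univ m]
  have h2 : ∏ j ∈ Finset.Ioi m, a m j = ∏ j, if m < j then a m j else 1 := by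
    rw [← Finset.prod_filter]; congr 1; ext; simp
  rw [if_pos (Finset.mem_univ _), h2, ← Finset.prod_mul_distrib, Fin.prod_univ_succAbove _ m]
  simp only [lt_irrefl, if_false, one_mul]
  refine Finset.prod_le_prod' fun i _ => ?_
  rcases lt_or_gt_of_ne (Fin.succAbove_ne m i) with h | h
  · simp [h, h.not_gt]
  · simp [h, h.not_gt]

lemma jng_edge_nonneg (γ t r : ℝ) (ht : 0 ≤ t) (hr : 0 ≤ r) : 0 ≤ edgeProb γ t r := by
  unfold edgeProb; split_ifs
  · norm_num
  · positivity

lemma jng_edge_le_one (γ t r : ℝ) : edgeProb γ t r ≤ 1 := by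
  unfold edgeProb; split_ifs
  · norm_num
  · exact min_le_left _ _

lemma jng_edge_meas (γ t : ℝ) : Measurable (edgeProb γ t) := by
  unfold edgeProb
  refine Measurable.ite (measurableSet_singleton 0) measurable_const ?_
  fun_prop

lemma jng_ball {d : ℕ} (hd : 1 ≤ d) (a : Fin d → AddCircle (1 : ℝ)) (s : ℝ) (hs : 0 ≤ s) :
    volume {b : Fin d → AddCircle (1 : ℝ) | dist a b ^ d ≤ s} ≤ 2 ^ d * ENNReal.ofReal s := by
  set r : ℝ := s ^ (1 / (d : ℝ)) with hr
  have hr0 : 0 ≤ r := by positivity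
  have hrd : r ^ d = s := by
    rw [hr, ← Real.rpow_natCast, ← Real.rpow_mul hs, one_div, inv_mul_cancel₀ (by positivity),
      Real.rpow_one]
  have hsub : {b : Fin d → AddCircle (1 : ℝ) | dist a b ^ d ≤ s} ⊆ Metric.closedBall a r := by
    intro b hb
    change dist a b ^ d ≤ s at hb
    rw [← hrd] at hb
    rw [Metric.mem_closedBall, dist_comm]
    exact le_of_pow_le_pow_left₀ (by omega) hr0 hb
  refine (measure_mono hsub).trans ?_
  rw [volume_pi, Measure.pi_closedBall _ _ hr0]
  simp_rw [AddCircle.volume_closedBall]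
  rw [Finset.prod_const, Finset.card_univ, Fintype.card_fin]
  calc ENNReal.ofReal (min 1 (2 * r)) ^ d ≤ ENNReal.ofReal (2 * r) ^ d := by
        gcongr; exact min_le_right _ _
    _ = _ := by
        rw [ENNReal.ofReal_mul (by norm_num), mul_pow, ← ENNReal.ofReal_pow hr0, hrd]
        simp

lemma jng_edge_sum (γ t r : ℝ) (hγ : 1 < γ) (ht : 0 < t) :
    ENNReal.ofReal (edgeProb γ t r) ≤
      ∑' n : ℕ, ENNReal.ofReal (((2 : ℝ) ^ (-γ)) ^ n) *
        (if r ≤ t * 2 ^ (n + 1) then 1 else 0) := by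
  rcases le_or_gt r t with h | h
  · refine le_trans ?_ (ENNReal.le_tsum 0)
    rw [if_pos (by norm_num; linarith)]
    simpa using jng_edge_le_one γ t r
  · obtain ⟨n, h1, h2⟩ := exists_nat_pow_near (x := r / t) (y := 2)
      (by rw [le_div_iff₀ ht]; linarith) (by norm_num)
    refine le_trans ?_ (ENNReal.le_tsum n)
    rw [div_lt_iff₀ ht] at h2
    rw [le_div_iff₀ ht] at h1
    rw [if_pos (by linarith), mul_one]
    apply ENNReal.ofReal_le_ofReal
    have hr' : 0 < r := ht.trans h
    unfold edgeProb
    rw [if_neg hr'.ne']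
    refine (min_le_right _ _).trans ?_
    have : ((2 : ℝ) ^ (-γ)) ^ n = ((2 ^ n)⁻¹ : ℝ) ^ γ := by
      rw [← Real.rpow_natCast, ← Real.rpow_mul (by norm_num), ← Real.rpow_natCast,
        ← Real.rpow_neg (by norm_num), ← Real.rpow_mul (by norm_num)]
      congr 1; ring
    rw [this]
    apply Real.rpow_le_rpow (by positivity) _ (by linarith)
    rw [div_le_iff₀ hr', inv_mul_eq_div, le_div_iff₀ (by positivity)]
    linarith

lemma jng_edge_int (d : ℕ) (hd : 1 ≤ d) (γ : ℝ) (hγ : 1 < γ) :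
    ∃ C : ℝ≥0∞, C < ⊤ ∧ ∀ (t : ℝ), 0 < t → ∀ a : Fin d → AddCircle (1 : ℝ),
      ∫⁻ b, ENNReal.ofReal (edgeProb γ t (dist a b ^ d)) ≤ min 1 (C * ENNReal.ofReal t) := by
  refine ⟨∑' n : ℕ, 2 ^ d * 2 * ENNReal.ofReal (((2 : ℝ) ^ (1 - γ)) ^ n), ?_, ?_⟩
  · rw [ENNReal.tsum_mul_left, lt_top_iff_ne_top]
    refine ENNReal.mul_ne_top (by finiteness) ?_
    have hlt : (2 : ℝ) ^ (1 - γ) < 1 :=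
      Real.rpow_lt_one_of_one_lt_of_neg (by norm_num) (by linarith)
    exact (summable_geometric_of_lt_one (by positivity) hlt).tsum_ofReal_ne_top
  · intro t ht a
    refine le_min ?_ ?_
    · calc _ ≤ ∫⁻ b : Fin d → AddCircle (1 : ℝ), 1 := lintegral_mono fun b => by
            simpa using jng_edge_le_one _ _ _
        _ = 1 := by simp [volume_pi, Measure.pi_univ, AddCircle.measure_univ]
    · have hmeas : ∀ s : ℝ, MeasurableSet {b : Fin d → AddCircle (1 : ℝ) | dist a b ^ d ≤ s} :=
        fun s => (isClosed_le (by fun_prop) continuous_const).measurableSet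
      calc _ ≤ ∫⁻ b : Fin d → AddCircle (1 : ℝ), ∑' n : ℕ, ENNReal.ofReal (((2 : ℝ) ^ (-γ)) ^ n) *
            (if dist a b ^ d ≤ t * 2 ^ (n + 1) then 1 else 0) :=
            lintegral_mono fun b => jng_edge_sum _ _ _ hγ ht
        _ = ∑' n : ℕ, ENNReal.ofReal (((2 : ℝ) ^ (-γ)) ^ n) *
              volume {b : Fin d → AddCircle (1 : ℝ) | dist a b ^ d ≤ t * 2 ^ (n + 1)} := by
            rw [lintegral_tsum]
            · congr 1; ext n
              rw [lintegral_const_mul]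
              · congr 1
                rw [← lintegral_indicator_one (hmeas _)]
                rfl
              · exact Measurable.ite (hmeas _) measurable_const measurable_const
            · intro n
              exact ((Measurable.ite (hmeas _) measurable_const measurable_const).const_mul
                _).aemeasurable
        _ ≤ ∑' n : ℕ, ENNReal.ofReal (((2 : ℝ) ^ (-γ)) ^ n) *
              (2 ^ d * ENNReal.ofReal (t * 2 ^ (n + 1))) := by
            gcongr with n
            exact jng_ball hd a _ (by positivity)
        _ = _ := by
            rw [← ENNReal.tsum_mul_right]
            congr 1; ext n
            have h2 : (2 : ℝ) ^ (1 - γ) = 2 * 2 ^ (-γ) := by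
              rw [sub_eq_add_neg, Real.rpow_add (by norm_num), Real.rpow_one]
            rw [h2, mul_pow, pow_succ, ENNReal.ofReal_mul ht.le, ENNReal.ofReal_mul (by positivity),
              ENNReal.ofReal_mul (by positivity)]
            simp only [ENNReal.ofReal_ofNat]
            ring

noncomputable def jngH (C : ℝ≥0∞) (τ s z : ℝ) : ℝ≥0∞ :=
  if s ≤ z then ENNReal.ofReal (z ^ (-τ)) * min 1 (C * ENNReal.ofReal (s * z)) else 0

noncomputable def jngF (τ s : ℝ) : ℝ≥0∞ :=
  if 0 < s then ENNReal.ofReal (s ^ (-τ)) else 0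

lemma jngH_meas (C : ℝ≥0∞) (τ : ℝ) : Measurable (Function.uncurry (jngH C τ)) := by
  unfold Function.uncurry jngH
  refine Measurable.ite (measurableSet_le measurable_fst measurable_snd) ?_ measurable_const
  fun_prop

lemma jngF_meas (τ : ℝ) : Measurable (jngF τ) := by
  unfold jngF
  refine Measurable.ite measurableSet_Ioi ?_ measurable_const
  fun_prop

lemma jng_tail (a s : ℝ) (ha : a < -1) (hs : 0 < s) :
    ∫⁻ z in Set.Ici s, ENNReal.ofReal (z ^ a) =
      ENNReal.ofReal (1 / (-(a + 1))) * ENNReal.ofReal (s ^ (a + 1)) := by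
  rw [setLIntegral_congr Ioi_ae_eq_Ici.symm,
    ← ofReal_integral_eq_lintegral_ofReal (integrableOn_Ioi_rpow_of_lt ha hs),
    integral_Ioi_rpow_of_lt ha hs, ← ENNReal.ofReal_mul]
  · congr 1
    have : a + 1 ≠ 0 := by linarith
    field_simp
  · apply one_div_nonneg.2; linarith
  · filter_upwards [ae_restrict_mem measurableSet_Ioi] with z hz
    have : 0 < z := hs.trans hz
    positivity

lemma jngH_le (C : ℝ≥0∞) (τ s : ℝ) (hτ : 2 < τ) (hs : 0 < s) :
    ∫⁻ z, jngH C τ s z ≤ ENNReal.ofReal (1 / (-(-τ + 1))) * ENNReal.ofReal (s ^ (1 - τ)) := by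
  calc _ ≤ ∫⁻ z, (Set.Ici s).indicator (fun z => ENNReal.ofReal (z ^ (-τ))) z := by
        refine lintegral_mono fun z => ?_
        unfold jngH
        split_ifs with h
        · rw [Set.indicator_of_mem (show z ∈ Set.Ici s from h)]
          exact mul_le_of_le_one_right' (min_le_left _ _)
        · exact zero_le
    _ = _ := by
        rw [lintegral_indicator measurableSet_Ici, jng_tail _ _ (by linarith) hs,
          show -τ + 1 = 1 - τ by ring]

lemma jngH_le' (C : ℝ≥0∞) (τ s : ℝ) (hτ : 2 < τ) (hs : 0 < s) :
    ∫⁻ z, jngH C τ s z ≤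
      C * ENNReal.ofReal (1 / (-((1 - τ) + 1))) * ENNReal.ofReal (s ^ (3 - τ)) := by
  calc _ ≤ ∫⁻ z, (Set.Ici s).indicator
        (fun z => (C * ENNReal.ofReal s) * ENNReal.ofReal (z ^ (1 - τ))) z := by
        refine lintegral_mono fun z => ?_
        unfold jngH
        split_ifs with h
        · rw [Set.indicator_of_mem (show z ∈ Set.Ici s from h)]
          have hz : 0 < z := hs.trans_le h
          refine (mul_le_mul_right (min_le_right _ _) _).trans (le_of_eq ?_)
          rw [sub_eq_add_neg, Real.rpow_add hz, Real.rpow_one, ENNReal.ofReal_mul hz.le,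
            ENNReal.ofReal_mul hs.le]
          ring
        · exact zero_le
    _ = _ := by
        rw [lintegral_indicator measurableSet_Ici, lintegral_const_mul _ (by fun_prop),
          jng_tail _ _ (by linarith) hs]
        rw [show 3 - τ = 1 + (1 - τ + 1) by ring, Real.rpow_add hs 1, Real.rpow_one,
          ENNReal.ofReal_mul hs.le]
        ring

lemma jng_final (C : ℝ≥0∞) (hC : C < ⊤) (n : ℕ) (τ : ℝ) (hτ : 2 < τ)
    (h : 2 < ((n : ℝ) + 1) * (3 - τ)) :
    ∫⁻ s, jngF τ s * (∫⁻ z, jngH C τ s z) ^ n < ⊤ := by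
  set D1 : ℝ≥0∞ := C * ENNReal.ofReal (1 / (-((1 - τ) + 1))) with hD1
  set D2 : ℝ≥0∞ := ENNReal.ofReal (1 / (-(-τ + 1))) with hD2
  have hD1t : D1 ≠ ⊤ := ENNReal.mul_ne_top hC.ne ENNReal.ofReal_ne_top
  have hD2t : D2 ≠ ⊤ := ENNReal.ofReal_ne_top
  have key : ∀ e s : ℝ, 0 < s → ENNReal.ofReal (s ^ (-τ)) * ENNReal.ofReal (s ^ e) ^ n
      = ENNReal.ofReal (s ^ (-τ + n * e)) := by
    intro e s hs
    rw [← ENNReal.ofReal_pow (by positivity), ← ENNReal.ofReal_mul (by positivity),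
      Real.rpow_add hs, mul_comm (n : ℝ) e, Real.rpow_mul hs.le, Real.rpow_natCast]
  have hn : (0 : ℝ) ≤ n := n.cast_nonneg
  have hle : ∀ s, jngF τ s * (∫⁻ z, jngH C τ s z) ^ n ≤
      (Set.Ioo (0 : ℝ) 1).indicator
        (fun s => D1 ^ n * ENNReal.ofReal (s ^ (-τ + n * (3 - τ)))) s +
      (Set.Ici (1 : ℝ)).indicator
        (fun s => D2 ^ n * ENNReal.ofReal (s ^ (-τ + n * (1 - τ)))) s := by
    intro s
    unfold jngF
    split_ifs with hs
    · rcases lt_or_ge s 1 with h1 | h1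
      · refine le_trans ?_ le_self_add
        rw [Set.indicator_of_mem (show s ∈ Set.Ioo (0 : ℝ) 1 from ⟨hs, h1⟩)]
        refine (mul_le_mul_right (pow_le_pow_left' (jngH_le' C τ s hτ hs) n) _).trans ?_
        rw [← key _ _ hs, mul_pow, ← hD1]
        exact le_of_eq (by ring)
      · refine le_trans ?_ le_add_self
        rw [Set.indicator_of_mem (show s ∈ Set.Ici (1 : ℝ) from h1)]
        refine (mul_le_mul_right (pow_le_pow_left' (jngH_le C τ s hτ hs) n) _).trans ?_
        rw [← key _ _ hs, mul_pow, ← hD2]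
        exact le_of_eq (by ring)
    · simp
  refine (lintegral_mono hle).trans_lt ?_
  rw [lintegral_add_left (Measurable.indicator (by fun_prop) measurableSet_Ioo),
    lintegral_indicator measurableSet_Ioo, lintegral_indicator measurableSet_Ici,
    lintegral_const_mul _ (by fun_prop), lintegral_const_mul _ (by fun_prop),
    jng_tail _ _ (by nlinarith) one_pos]
  refine ENNReal.add_lt_top.2 ⟨ENNReal.mul_lt_top (ENNReal.pow_lt_top hD1t.lt_top) ?_,
    ENNReal.mul_lt_top (ENNReal.pow_lt_top hD2t.lt_top) (by finiteness)⟩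
  have := (intervalIntegral.integrableOn_Ioo_rpow_iff (s := -τ + n * (3 - τ)) one_pos).2
    (by nlinarith)
  exact this.lintegral_lt_top

lemma jng_pointwise {n d : ℕ} (τ γ : ℝ) (C : ℝ≥0∞)
    (hC : ∀ (t : ℝ), 0 < t → ∀ a : Fin d → AddCircle (1 : ℝ),
      ∫⁻ b, ENNReal.ofReal (edgeProb γ t (dist a b ^ d)) ≤ min 1 (C * ENNReal.ofReal t))
    (y : Fin (n + 1) → ℝ) (hy : ∀ i, 0 < y i) (m : Fin (n + 1)) (hm : ∀ i, y m ≤ y i) :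
    ∫⁻ x : Fin (n + 1) → Fin d → AddCircle (1 : ℝ),
        ENNReal.ofReal ((∏ i, y i ^ (-τ)) *
          ∏ i : Fin (n + 1), ∏ j ∈ Finset.Ioi i,
            edgeProb γ (y i * y j) (dist (x i) (x j) ^ d)) ≤
      jngF τ (y m) * ∏ i : Fin n, jngH C τ (y m) (y (m.succAbove i)) := by
  have hnn : ∀ (x : Fin (n + 1) → Fin d → AddCircle (1 : ℝ)) i j,
      0 ≤ edgeProb γ (y i * y j) (dist (x i) (x j) ^ d) := fun x i j =>
    jng_edge_nonneg _ _ _ (mul_pos (hy i) (hy j)).le (by positivity)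
  have hP : 0 ≤ ∏ i, y i ^ (-τ) :=
    Finset.prod_nonneg fun i _ => Real.rpow_nonneg (hy i).le _
  calc _ ≤ ∫⁻ x : Fin (n + 1) → Fin d → AddCircle (1 : ℝ),
        (fun _ => ENNReal.ofReal (∏ i, y i ^ (-τ))) (x m) *
          ∏ i : Fin n, (fun (i : Fin n) (a b : Fin d → AddCircle (1 : ℝ)) => ENNReal.ofReal
            (edgeProb γ (y m * y (m.succAbove i)) (dist a b ^ d))) i (x m)
              (x (m.succAbove i)) := by
        refine lintegral_mono fun x => ?_
        simp only
        rw [ENNReal.ofReal_mul hP]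
        refine mul_le_mul_right ?_ _
        rw [ENNReal.ofReal_prod_of_nonneg fun i _ => Finset.prod_nonneg fun j _ => hnn x i j]
        simp_rw [fun i => ENNReal.ofReal_prod_of_nonneg (s := Finset.Ioi i)
          fun j _ => hnn x i j]
        refine jng_comb m (fun i j => ENNReal.ofReal
          (edgeProb γ (y i * y j) (dist (x i) (x j) ^ d))) (fun i j => ?_) fun i j => ?_
        · simpa using jng_edge_le_one _ _ _
        · simp only [mul_comm (y i), dist_comm (x i)]
    _ = ∫⁻ a : Fin d → AddCircle (1 : ℝ), ENNReal.ofReal (∏ i, y i ^ (-τ)) *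
          ∏ i : Fin n, ∫⁻ b, ENNReal.ofReal
            (edgeProb γ (y m * y (m.succAbove i)) (dist a b ^ d)) := by
        refine jng_star m (fun _ => ENNReal.ofReal (∏ i, y i ^ (-τ))) ?_
          (fun (i : Fin n) (a b : Fin d → AddCircle (1 : ℝ)) => ENNReal.ofReal
            (edgeProb γ (y m * y (m.succAbove i)) (dist a b ^ d))) ?_
        · exact measurable_const
        · intro i
          refine ENNReal.measurable_ofReal.comp ((jng_edge_meas _ _).comp ?_)
          have : Continuous fun p : (Fin d → AddCircle (1 : ℝ)) × (Fin d → AddCircle (1 : ℝ)) =>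
            dist p.1 p.2 ^ d := by fun_prop
          exact this.measurable
    _ ≤ ∫⁻ a : Fin d → AddCircle (1 : ℝ), ENNReal.ofReal (∏ i, y i ^ (-τ)) *
          ∏ i : Fin n, min 1 (C * ENNReal.ofReal (y m * y (m.succAbove i))) := by
        refine lintegral_mono fun a => mul_le_mul_right (Finset.prod_le_prod' fun i _ => ?_) _
        exact hC _ (mul_pos (hy _) (hy _)) a
    _ = _ := by
        rw [lintegral_const]
        have hu : volume (Set.univ : Set (Fin d → AddCircle (1 : ℝ))) = 1 := by
          simp [volume_pi, Measure.pi_univ, AddCircle.measure_univ]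
        rw [hu, mul_one, Fin.prod_univ_succAbove _ m,
          ENNReal.ofReal_mul (Real.rpow_nonneg (hy m).le _),
          ENNReal.ofReal_prod_of_nonneg fun i _ => Real.rpow_nonneg (hy _).le _,
          mul_assoc, ← Finset.prod_mul_distrib]
        unfold jngF jngH
        simp only [hy m, hm, if_true]

/-- In the non-geometric regime `k > 2/(3-τ)` the integral `J^{NG}` is finite.  Here the
torus `𝕋^d` is `Fin d → AddCircle 1` with its Haar probability measure, and
`dist x y = max_h |x^{(h)} - y^{(h)}|_C` is the sup of the circle distances. -/
theorem JNG_finite (k d : ℕ) (hk : 3 ≤ k) (hd : 1 ≤ d)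
    (τ γ : ℝ) (hτ : 2 < τ) (hτ' : τ < 3) (hγ : 1 < γ)
    (hkτ : (k : ℝ) > 2 / (3 - τ)) :
    ∫⁻ y : Fin k → ℝ in {y | ∀ i, 0 < y i},
      ∫⁻ x : Fin k → Fin d → AddCircle (1 : ℝ),
        ENNReal.ofReal ((∏ i, y i ^ (-τ)) *
          ∏ i : Fin k, ∏ j ∈ Finset.Ioi i,
            edgeProb γ (y i * y j) (dist (x i) (x j) ^ d)) < ⊤ := by
  obtain ⟨n, rfl⟩ : ∃ n, k = n + 1 := ⟨k - 1, by omega⟩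
  obtain ⟨C, hCt, hC⟩ := jng_edge_int d hd γ hγ
  have hmS : MeasurableSet {y : Fin (n + 1) → ℝ | ∀ i, 0 < y i} := by
    have : {y : Fin (n + 1) → ℝ | ∀ i, 0 < y i} = ⋂ i, {y | 0 < y i} := by ext; simp
    rw [this]
    exact MeasurableSet.iInter fun i => measurableSet_lt measurable_const (measurable_pi_apply i)
  have hmeas : ∀ m : Fin (n + 1), Measurable fun y : Fin (n + 1) → ℝ =>
      jngF τ (y m) * ∏ i : Fin n, jngH C τ (y m) (y (m.succAbove i)) := by
    intro m
    refine ((jngF_meas τ).comp (measurable_pi_apply m)).mul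
      (Finset.measurable_fun_prod _ fun i _ => ?_)
    have h2 : Measurable fun y : Fin (n + 1) → ℝ => (y m, y (m.succAbove i)) := by fun_prop
    exact (jngH_meas C τ).comp h2
  calc _ ≤ ∫⁻ y : Fin (n + 1) → ℝ in {y | ∀ i, 0 < y i}, ∑ m : Fin (n + 1),
        jngF τ (y m) * ∏ i : Fin n, jngH C τ (y m) (y (m.succAbove i)) := by
        refine setLIntegral_mono' hmS fun y hy => ?_
        obtain ⟨m, hm⟩ := Finite.exists_min y
        refine (jng_pointwise τ γ C hC y hy m hm).trans ?_
        exact Finset.single_le_sum (f := fun m => jngF τ (y m) *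
          ∏ i : Fin n, jngH C τ (y m) (y (m.succAbove i))) (fun _ _ => zero_le)
          (Finset.mem_univ m)
    _ ≤ ∫⁻ y : Fin (n + 1) → ℝ, ∑ m : Fin (n + 1),
        jngF τ (y m) * ∏ i : Fin n, jngH C τ (y m) (y (m.succAbove i)) :=
        setLIntegral_le_lintegral _ _
    _ = ∑ m : Fin (n + 1), ∫⁻ s, jngF τ s * (∫⁻ z, jngH C τ s z) ^ n := by
        rw [lintegral_finsetSum _ fun m _ => hmeas m]
        refine Finset.sum_congr rfl fun m _ => ?_
        rw [jng_star m (jngF τ) (jngF_meas τ) (fun _ => jngH C τ) fun _ => jngH_meas C τ]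
        simp
    _ < ⊤ := by
        refine ENNReal.sum_lt_top.2 fun m _ => jng_final C hCt n τ hτ ?_
        have h3 : 0 < 3 - τ := by linarith
        rw [gt_iff_lt, div_lt_iff₀ h3] at hkτ
        push_cast at hkτ
        exact hkτ
end

section
/- Fix an integer k ≥ 3, an integer d ≥ 1, and reals τ ∈ (2,3), γ > 1, w₀ > 0. If k < 2/(3−τ), then the integral J^{G} := ∫_{[w₀,∞)^k} ∫_{(ℝ^d)^{k−1}} (w₁⋯w_k)^{−τ} ∏_{1≤i<j≤k} min{1, (w_i w_j/‖z_i − z_j‖_∞^d)^γ} dz₂⋯dz_k dw₁⋯dw_k is finite, where by convention z₁ := 0 ∈ ℝ^d. -/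
open MeasureTheory Real Finset
open scoped ENNReal Topology

/-- The extension of `z = (z₂,...,z_k) ∈ (ℝ^d)^{k-1}` to a `k`-tuple with the convention
`z₁ = 0`. -/
noncomputable def withOrigin (k d : ℕ) (z : Fin (k - 1) → Fin d → ℝ) (i : Fin k) :
    Fin d → ℝ :=
  if h : (i : ℕ) = 0 then 0 else z ⟨(i : ℕ) - 1, by have := i.isLt; omega⟩

theorem aux_insert {n : ℕ} {E : Type} [MeasureSpace E] [SigmaFinite (volume : Measure E)]
    (p : Fin (n + 1)) (F : (Fin (n + 1) → E) → ℝ≥0∞) (hF : Measurable F) :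
    ∫⁻ z, F z = ∫⁻ a, ∫⁻ z' : Fin n → E, F (p.insertNth a z') := by
  have h := (volume_preserving_piFinSuccAbove (fun _ : Fin (n + 1) => E) p).symm
  rw [← h.lintegral_comp hF, Measure.volume_eq_prod, lintegral_prod]
  · rfl
  · exact (hF.comp (MeasurableEquiv.measurable _)).aemeasurable

theorem aux_pi {E : Type} [MeasureSpace E] [SigmaFinite (volume : Measure E)] (n : ℕ)
    (f : Fin n → E → ℝ≥0∞) (hf : ∀ i, Measurable (f i)) :
    ∫⁻ z : Fin n → E, ∏ i, f i (z i) = ∏ i, ∫⁻ x, f i x := by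
  induction n with
  | zero => simp [lintegral_const, volume_pi]
  | succ n ih =>
    rw [aux_insert 0 _ (by fun_prop), Fin.prod_univ_succ]
    simp only [Fin.prod_univ_succ, Fin.insertNth_zero', Fin.cons_zero, Fin.cons_succ]
    have : ∀ a : E, ∫⁻ z' : Fin n → E, f 0 a * ∏ i : Fin n, f i.succ (z' i)
        = f 0 a * ∏ i : Fin n, ∫⁻ x, f i.succ x := by
      intro a
      rw [lintegral_const_mul _ (by fun_prop), ih (fun i => f i.succ) (fun i => hf _)]
    rw [lintegral_congr this]
    rw [lintegral_mul_const _ (hf 0)]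

theorem aux_wo (n d : ℕ) (z : Fin n → Fin d → ℝ) :
    withOrigin (n + 1) d z = (Fin.cons 0 z : Fin (n + 1) → Fin d → ℝ) := by
  funext i
  refine Fin.cases ?_ (fun j => ?_) i
  · simp [withOrigin]
  · simp [withOrigin]

theorem aux_star (n d : ℕ) (m : Fin (n + 1)) (f : Fin n → (Fin d → ℝ) → ℝ≥0∞)
    (hf : ∀ i, Measurable (f i)) (he : ∀ i x, f i (-x) = f i x) :
    ∫⁻ z : Fin n → Fin d → ℝ, ∏ j, f j ((Fin.cons 0 z : Fin (n + 1) → Fin d → ℝ) m -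
      (Fin.cons 0 z : Fin (n + 1) → Fin d → ℝ) (m.succAbove j)) = ∏ j, ∫⁻ x, f j x := by
  have key : ∀ (n : ℕ) (f : Fin n → (Fin d → ℝ) → ℝ≥0∞) (_ : ∀ i, Measurable (f i))
      (a : Fin d → ℝ), ∫⁻ z : Fin n → Fin d → ℝ, ∏ j, f j (a - z j) = ∏ j, ∫⁻ x, f j x := by
    intro n f hf a
    rw [aux_pi n (fun j x => f j (a - x)) (fun i => (hf i).comp (by fun_prop))]
    exact Finset.prod_congr rfl fun j _ => lintegral_sub_left_eq_self (f j) a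
  refine Fin.cases ?_ (fun p => ?_) m
  · simpa using! key n f hf 0
  · cases n with
    | zero => exact p.elim0
    | succ n =>
      rw [aux_insert p]
      · simp only [Fin.cons_succ, Fin.insertNth_apply_same]
        simp only [Fin.prod_univ_succ, Fin.succ_succAbove_zero, Fin.succ_succAbove_succ,
          Fin.cons_zero, Fin.cons_succ, Fin.insertNth_apply_succAbove, sub_zero]
        have : ∀ a : Fin d → ℝ, ∫⁻ z' : Fin n → Fin d → ℝ, f 0 a * ∏ i : Fin n, f i.succ (a - z' i)
            = f 0 a * ∏ i : Fin n, ∫⁻ x, f i.succ x := by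
          intro a
          rw [lintegral_const_mul, key n (fun i => f i.succ) (fun i => hf _)]
          exact Finset.measurable_prod _ fun i _ => (hf _).comp (by fun_prop)
        simp only [this]
        rw [lintegral_mul_const _ (hf 0)]
      · refine Finset.measurable_prod _ fun j _ => (hf j).comp ?_
        have h : ∀ i : Fin (n + 2), Measurable fun z : Fin (n + 1) → Fin d → ℝ =>
            (Fin.cons 0 z : Fin (n + 2) → Fin d → ℝ) i := by
          intro i
          refine Fin.cases ?_ (fun j => ?_) i
          · simp
          · simpa using measurable_pi_apply j
        exact (h _).sub (h _)

theorem aux_edge_nonneg {γ t r : ℝ} (ht : 0 ≤ t) (hr : 0 ≤ r) : 0 ≤ edgeProb γ t r := by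
  unfold edgeProb
  split_ifs
  · exact zero_le_one
  · exact le_min zero_le_one (by positivity)

theorem aux_edge_le_one {γ t r : ℝ} : edgeProb γ t r ≤ 1 := by
  unfold edgeProb
  split_ifs
  · exact le_rfl
  · exact min_le_left _ _

theorem aux_edge_meas (γ t : ℝ) (d : ℕ) :
    Measurable fun x : Fin d → ℝ => ENNReal.ofReal (edgeProb γ t (‖x‖ ^ d)) := by
  have : Measurable fun r : ℝ => edgeProb γ t r := by
    unfold edgeProb
    refine Measurable.ite (measurableSet_eq) measurable_const ?_
    fun_prop
  exact (this.comp (by fun_prop)).ennreal_ofReal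

theorem aux_edge_bound (d : ℕ) (hd : 1 ≤ d) {γ t s y : ℝ} (hγ : 1 < γ) (hs : 0 < s)
    (hst : s ^ d = t) (hy : 0 ≤ y) :
    edgeProb γ t ((s * y) ^ d) ≤ 2 ^ (γ * d) * (1 + y) ^ (-(γ * d)) := by
  have hd' : (0 : ℝ) < d := by exact_mod_cast hd
  have hr : 0 < γ * d := by positivity
  have e : (2 : ℝ) ^ (γ * d) * (1 + y) ^ (-(γ * d)) = ((1 + y) / 2) ^ (-(γ * d)) := by
    rw [Real.div_rpow (by positivity) (by norm_num), Real.rpow_neg (by norm_num : (0:ℝ) ≤ 2),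
      div_inv_eq_mul, mul_comm]
  rw [e]
  rcases le_or_gt y 1 with h | h
  · refine aux_edge_le_one.trans ?_
    exact Real.one_le_rpow_of_pos_of_le_one_of_nonpos (by positivity) (by linarith) (by linarith)
  · have hy0 : 0 < y := by linarith
    unfold edgeProb
    rw [if_neg (by positivity)]
    refine (min_le_right _ _).trans ?_
    have : (t / (s * y) ^ d) ^ γ = y ^ (-(γ * d)) := by
      rw [← hst, mul_pow, div_mul_cancel_left₀ (by positivity), ← Real.rpow_natCast,
        ← Real.rpow_neg hy, ← Real.rpow_mul hy]
      congr 1; ring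
    rw [this]
    exact Real.rpow_le_rpow_of_nonpos (by positivity) (by linarith) (by linarith)

theorem aux_edge_int (d : ℕ) (hd : 1 ≤ d) (γ : ℝ) (hγ : 1 < γ) :
    ∃ C : ℝ≥0∞, C ≠ ⊤ ∧ ∀ t : ℝ, 0 < t →
      ∫⁻ x : Fin d → ℝ, ENNReal.ofReal (edgeProb γ t (‖x‖ ^ d)) ≤ C * ENNReal.ofReal t := by
  have hd' : (0 : ℝ) < d := by exact_mod_cast hd
  have hfin := finite_integral_one_add_norm (E := Fin d → ℝ) (μ := volume) (r := γ * d)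
    (by simp; nlinarith)
  refine ⟨ENNReal.ofReal (2 ^ (γ * d)) *
    ∫⁻ x : Fin d → ℝ, ENNReal.ofReal ((1 + ‖x‖) ^ (-(γ * d))),
    ENNReal.mul_ne_top ENNReal.ofReal_ne_top hfin.ne, fun t ht => ?_⟩
  set s : ℝ := t ^ ((d : ℝ)⁻¹) with hs
  have hs0 : 0 < s := by positivity
  have hst : s ^ d = t := Real.rpow_inv_natCast_pow ht.le (by omega)
  have hm : Measurable fun x : Fin d → ℝ => ENNReal.ofReal ((1 + ‖x‖) ^ (-(γ * d))) := by
    fun_prop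
  calc ∫⁻ x : Fin d → ℝ, ENNReal.ofReal (edgeProb γ t (‖x‖ ^ d))
      ≤ ∫⁻ x : Fin d → ℝ, ENNReal.ofReal (2 ^ (γ * d)) *
          ENNReal.ofReal ((1 + ‖s⁻¹ • x‖) ^ (-(γ * d))) := by
        refine lintegral_mono fun x => ?_
        rw [← ENNReal.ofReal_mul (by positivity)]
        refine ENNReal.ofReal_le_ofReal ?_
        have h := aux_edge_bound d hd hγ hs0 hst (norm_nonneg (s⁻¹ • x))
        have h2 : s * ‖s⁻¹ • x‖ = ‖x‖ := by
          rw [norm_smul, Real.norm_of_nonneg (by positivity), mul_inv_cancel_left₀ hs0.ne']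
        rwa [h2] at h
    _ = ENNReal.ofReal (2 ^ (γ * d)) *
          ∫⁻ x : Fin d → ℝ, ENNReal.ofReal ((1 + ‖x‖) ^ (-(γ * d))) ∂(Measure.map (s⁻¹ • ·) volume) := by
        rw [lintegral_const_mul _ (by fun_prop), lintegral_map hm (by fun_prop)]
    _ = _ := by
        rw [Measure.map_addHaar_smul _ (by positivity), lintegral_smul_measure]
        have : |((s⁻¹) ^ Module.finrank ℝ (Fin d → ℝ))⁻¹| = t := by
          simp [hst, abs_of_pos ht]
        rw [this, smul_eq_mul]
        ring

theorem aux_prod_le (n : ℕ) (m : Fin (n + 1)) (E : Fin (n + 1) → Fin (n + 1) → ℝ)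
    (hsymm : ∀ i j, E i j = E j i) (h0 : ∀ i j, 0 ≤ E i j) (h1 : ∀ i j, E i j ≤ 1) :
    ∏ i, ∏ j ∈ Finset.Ioi i, E i j ≤ ∏ j : Fin n, E m (m.succAbove j) := by
  rw [Finset.prod_sigma']
  let φ : Fin n → (Σ _ : Fin (n + 1), Fin (n + 1)) := fun j =>
    if m < m.succAbove j then ⟨m, m.succAbove j⟩ else ⟨m.succAbove j, m⟩
  have hφ : Function.Injective φ := by
    intro a b hab
    have ha := Fin.succAbove_ne m a
    have hb := Fin.succAbove_ne m b
    apply Fin.succAbove_right_injective (p := m)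
    simp only [φ] at hab
    split_ifs at hab <;> simp at hab <;> grind
  calc _ ≤ ∏ p ∈ Finset.univ.image φ, E p.1 p.2 := by
        refine Finset.prod_le_prod_of_subset_of_le_one ?_ (fun i _ => h0 _ _) (fun i _ _ => h1 _ _)
        intro p hp
        obtain ⟨j, -, rfl⟩ := Finset.mem_image.1 hp
        have ha := Fin.succAbove_ne m j
        simp only [φ]
        split_ifs with h
        · simpa using h
        · simpa using lt_of_le_of_ne (not_lt.1 h) ha
    _ = _ := by
        rw [Finset.prod_image (fun a _ b _ h => hφ h)]
        refine Finset.prod_congr rfl fun j _ => ?_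
        simp only [φ]
        split_ifs
        · rfl
        · exact hsymm _ _

theorem aux_tail (a c : ℝ) (ha : a < -1) (hc : 0 < c) :
    ∫⁻ u : ℝ, (if c ≤ u then ENNReal.ofReal (u ^ a) else 0)
      = ENNReal.ofReal (-c ^ (a + 1) / (a + 1)) := by
  have : ∀ u : ℝ, (if c ≤ u then ENNReal.ofReal (u ^ a) else 0)
      = (Set.Ici c).indicator (fun u => ENNReal.ofReal (u ^ a)) u := by
    intro u; simp [Set.indicator_apply]
  simp only [this]
  rw [lintegral_indicator measurableSet_Ici, setLIntegral_congr Ioi_ae_eq_Ici.symm,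
    ← integral_Ioi_rpow_of_lt ha hc, ofReal_integral_eq_lintegral_ofReal]
  · exact integrableOn_Ioi_rpow_of_lt ha hc
  · refine (ae_restrict_iff' measurableSet_Ioi).2 (Filter.Eventually.of_forall fun x hx => ?_)
    exact Real.rpow_nonneg (hc.trans hx).le _

theorem aux_w (n : ℕ) (m : Fin (n + 1)) (τ w₀ : ℝ) (hτ : 2 < τ) (hw₀ : 0 < w₀)
    (hk : ((n : ℝ) + 1) * (3 - τ) < 2) (K : ℝ≥0∞) (hK : K ≠ ⊤) :
    ∫⁻ w : Fin (n + 1) → ℝ, K * ((if w₀ ≤ w m then ENNReal.ofReal (w m ^ ((n : ℝ) - τ)) else 0) *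
      ∏ j : Fin n, (if w m ≤ w (m.succAbove j) then
        ENNReal.ofReal (w (m.succAbove j) ^ (1 - τ)) else 0)) < ⊤ := by
  have hm1 : ∀ a b : ℝ, Measurable fun x : ℝ => if a ≤ x then ENNReal.ofReal (x ^ b) else 0 := by
    intro a b
    exact Measurable.ite measurableSet_Ici (by fun_prop) measurable_const
  have hm2 : ∀ j : Fin n, Measurable fun w : Fin (n + 1) → ℝ => if w m ≤ w (m.succAbove j) then
        ENNReal.ofReal (w (m.succAbove j) ^ (1 - τ)) else 0 := by
    intro j
    exact Measurable.ite (measurableSet_le (by fun_prop) (by fun_prop)) (by fun_prop)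
      measurable_const
  have hm3 : Measurable fun w : Fin (n + 1) → ℝ =>
      (if w₀ ≤ w m then ENNReal.ofReal (w m ^ ((n : ℝ) - τ)) else 0) := 
    (hm1 w₀ _).comp (measurable_pi_apply m)
  have hm4 : Measurable fun w : Fin (n + 1) → ℝ =>
      ((if w₀ ≤ w m then ENNReal.ofReal (w m ^ ((n : ℝ) - τ)) else 0) *
      ∏ j : Fin n, (if w m ≤ w (m.succAbove j) then
        ENNReal.ofReal (w (m.succAbove j) ^ (1 - τ)) else 0)) :=
    hm3.mul (Finset.measurable_prod Finset.univ fun j _ => hm2 j)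
  rw [lintegral_const_mul _ hm4]
  refine ENNReal.mul_lt_top hK.lt_top ?_
  rw [aux_insert m _ hm4]
  simp only [Fin.insertNth_apply_same, Fin.insertNth_apply_succAbove]
  have h1 : ∀ a : ℝ, ∫⁻ z' : Fin n → ℝ,
      (if w₀ ≤ a then ENNReal.ofReal (a ^ ((n : ℝ) - τ)) else 0) *
        ∏ j : Fin n, (if a ≤ z' j then ENNReal.ofReal (z' j ^ (1 - τ)) else 0)
      = ENNReal.ofReal ((τ - 2)⁻¹ ^ n) *
        (if w₀ ≤ a then ENNReal.ofReal (a ^ ((n : ℝ) - τ + n * (2 - τ))) else 0) := by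
    intro a
    split_ifs with h
    · have ha : 0 < a := hw₀.trans_le h
      rw [lintegral_const_mul, aux_pi n (fun _ x => if a ≤ x then ENNReal.ofReal (x ^ (1 - τ)) else 0)
        (fun _ => hm1 a _)]
      · simp only [aux_tail (1 - τ) a (by linarith) ha]
        rw [Finset.prod_const, Finset.card_univ, Fintype.card_fin]
        have e : -a ^ (1 - τ + 1) / (1 - τ + 1) = (τ - 2)⁻¹ * a ^ (2 - τ) := by
          have h2 : τ - 2 ≠ 0 := by linarith
          have h3 : 1 - τ + 1 = -(τ - 2) := by ring
          have h4 : 2 - τ = -(τ - 2) := by ring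
          rw [h3, h4, neg_div_neg_eq, div_eq_inv_mul]
        have h2 : 0 < τ - 2 := by linarith
        rw [e, ← ENNReal.ofReal_pow (by positivity), ← ENNReal.ofReal_mul (by positivity),
          ← ENNReal.ofReal_mul (by positivity)]
        congr 1
        rw [mul_pow, Real.rpow_add ha, mul_comm (n : ℝ) (2 - τ), Real.rpow_mul ha.le,
          Real.rpow_natCast]
        ring
      · exact Finset.measurable_prod _ fun j _ => (hm1 a _).comp (measurable_pi_apply j)
    · simp
  simp only [h1]
  rw [lintegral_const_mul _ (hm1 _ _), aux_tail _ _ (by linarith) hw₀]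
  exact ENNReal.mul_lt_top ENNReal.ofReal_lt_top ENNReal.ofReal_lt_top

theorem aux_main (n d : ℕ) (hd : 1 ≤ d)
    (τ γ w₀ : ℝ) (hτ : 2 < τ) (hγ : 1 < γ) (hw₀ : 0 < w₀)
    (hk : ((n : ℝ) + 1) * (3 - τ) < 2) :
    ∫⁻ w : Fin (n + 1) → ℝ in {w | ∀ i, w₀ ≤ w i},
      ∫⁻ z : Fin n → Fin d → ℝ,
        ENNReal.ofReal ((∏ i, w i ^ (-τ)) *
          ∏ i : Fin (n + 1), ∏ j ∈ Finset.Ioi i,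
            edgeProb γ (w i * w j)
              (‖withOrigin (n + 1) d z i - withOrigin (n + 1) d z j‖ ^ d)) < ⊤ := by
  obtain ⟨C, hC, hCb⟩ := aux_edge_int d hd γ hγ
  let A : Fin (n + 1) → Set (Fin (n + 1) → ℝ) := fun m =>
    {w | w₀ ≤ w m ∧ ∀ j, w m ≤ w (m.succAbove j)}
  have hA : ∀ m, MeasurableSet (A m) := by
    intro m
    rw [show A m = {w | w₀ ≤ w m} ∩ ⋂ j, {w | w m ≤ w (m.succAbove j)} by ext; simp [A]]
    refine (measurableSet_le measurable_const (measurable_pi_apply m)).inter ?_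
    exact MeasurableSet.iInter fun j => measurableSet_le (by fun_prop) (by fun_prop)
  have hsub : {w : Fin (n + 1) → ℝ | ∀ i, w₀ ≤ w i} ⊆ ⋃ m, A m := by
    intro w hw
    obtain ⟨m, hm⟩ := Finite.exists_min w
    exact Set.mem_iUnion.2 ⟨m, hw m, fun j => hm _⟩
  refine (lintegral_mono_set hsub).trans_lt ((lintegral_iUnion_le _ _).trans_lt ?_)
  rw [tsum_fintype]
  refine ENNReal.sum_lt_top.2 fun m _ => ?_
  refine lt_of_le_of_lt ?_ (aux_w n m τ w₀ hτ hw₀ hk (C ^ n) (ENNReal.pow_ne_top hC))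
  rw [← lintegral_indicator (hA m)]
  refine lintegral_mono fun w => ?_
  by_cases hw : w ∈ A m
  swap
  · simp [Set.indicator_of_notMem hw]
  rw [Set.indicator_of_mem hw]
  obtain ⟨hw1, hw2⟩ := hw
  have hm0 : 0 < w m := hw₀.trans_le hw1
  have hpos : ∀ i, 0 < w i := by
    rw [Fin.forall_iff_succAbove m]
    exact ⟨hm0, fun j => hm0.trans_le (hw2 j)⟩
  simp only [if_pos hw1, if_pos (hw2 _)]
  have hP : 0 ≤ ∏ i, w i ^ (-τ) := Finset.prod_nonneg fun i _ => Real.rpow_nonneg (hpos i).le _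
  calc ∫⁻ z : Fin n → Fin d → ℝ,
        ENNReal.ofReal ((∏ i, w i ^ (-τ)) *
          ∏ i : Fin (n + 1), ∏ j ∈ Finset.Ioi i,
            edgeProb γ (w i * w j)
              (‖withOrigin (n + 1) d z i - withOrigin (n + 1) d z j‖ ^ d))
      ≤ ∫⁻ z : Fin n → Fin d → ℝ, ENNReal.ofReal (∏ i, w i ^ (-τ)) *
          ∏ j : Fin n, ENNReal.ofReal (edgeProb γ (w m * w (m.succAbove j))
            (‖(Fin.cons 0 z : Fin (n + 1) → Fin d → ℝ) m -
              (Fin.cons 0 z : Fin (n + 1) → Fin d → ℝ) (m.succAbove j)‖ ^ d)) := by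
        refine lintegral_mono fun z => ?_
        have hn : ∀ i j, 0 ≤ edgeProb γ (w i * w j)
              (‖withOrigin (n + 1) d z i - withOrigin (n + 1) d z j‖ ^ d) := fun i j =>
          aux_edge_nonneg (mul_nonneg (hpos i).le (hpos j).le) (by positivity)
        have h := aux_prod_le n m (fun i j => edgeProb γ (w i * w j)
              (‖withOrigin (n + 1) d z i - withOrigin (n + 1) d z j‖ ^ d))
              (fun i j => by simp only [mul_comm (w i), norm_sub_rev]) hn
              (fun i j => aux_edge_le_one)
        rw [ENNReal.ofReal_mul hP]
        gcongr
        refine (ENNReal.ofReal_le_ofReal h).trans ?_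
        rw [ENNReal.ofReal_prod_of_nonneg (fun j _ => hn _ _), aux_wo]
    _ = ENNReal.ofReal (∏ i, w i ^ (-τ)) * ∏ j : Fin n, ∫⁻ x : Fin d → ℝ,
          ENNReal.ofReal (edgeProb γ (w m * w (m.succAbove j)) (‖x‖ ^ d)) := by
        rw [lintegral_const_mul' _ _ ENNReal.ofReal_ne_top,
          aux_star n d m (fun j x => ENNReal.ofReal
            (edgeProb γ (w m * w (m.succAbove j)) (‖x‖ ^ d)))
            (fun j => aux_edge_meas _ _ _) (fun j x => by simp only [norm_neg])]
    _ ≤ ENNReal.ofReal (∏ i, w i ^ (-τ)) *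
          ∏ j : Fin n, (C * ENNReal.ofReal (w m * w (m.succAbove j))) := by
        gcongr with j
        exact hCb _ (mul_pos (hpos _) (hpos _))
    _ = C ^ n * (ENNReal.ofReal (w m ^ ((n : ℝ) - τ)) *
          ∏ j : Fin n, ENNReal.ofReal (w (m.succAbove j) ^ (1 - τ))) := by
        rw [Finset.prod_mul_distrib, Finset.prod_const, Finset.card_univ, Fintype.card_fin,
          mul_left_comm]
        congr 1
        rw [← ENNReal.ofReal_prod_of_nonneg (fun j _ => (mul_pos (hpos _) (hpos _)).le),
          ← ENNReal.ofReal_prod_of_nonneg (fun j _ => Real.rpow_nonneg (hpos _).le _),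
          ← ENNReal.ofReal_mul hP, ← ENNReal.ofReal_mul (Real.rpow_nonneg hm0.le _)]
        congr 1
        rw [Fin.prod_univ_succAbove _ m, Finset.prod_mul_distrib, Finset.prod_const,
          Finset.card_univ, Fintype.card_fin, sub_eq_add_neg (n : ℝ), Real.rpow_add hm0,
          Real.rpow_natCast]
        have : ∀ j : Fin n, w (m.succAbove j) ^ (1 - τ)
            = w (m.succAbove j) ^ (-τ) * w (m.succAbove j) := by
          intro j
          rw [sub_eq_neg_add, Real.rpow_add (hpos _), Real.rpow_one]
        simp only [this, Finset.prod_mul_distrib]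
        ring

/-- In the geometric regime `k < 2/(3-τ)` the integral `J^{G}` is finite.  Here
`Fin d → ℝ` carries the sup norm `‖·‖_∞` and `(ℝ^d)^{k-1}` Lebesgue measure. -/
theorem JG_finite (k d : ℕ) (hk : 3 ≤ k) (hd : 1 ≤ d)
    (τ γ w₀ : ℝ) (hτ : 2 < τ) (hτ' : τ < 3) (hγ : 1 < γ) (hw₀ : 0 < w₀)
    (hkτ : (k : ℝ) < 2 / (3 - τ)) :
    ∫⁻ w : Fin k → ℝ in {w | ∀ i, w₀ ≤ w i},
      ∫⁻ z : Fin (k - 1) → Fin d → ℝ,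
        ENNReal.ofReal ((∏ i, w i ^ (-τ)) *
          ∏ i : Fin k, ∏ j ∈ Finset.Ioi i,
            edgeProb γ (w i * w j)
              (‖withOrigin k d z i - withOrigin k d z j‖ ^ d)) < ⊤ := by
  obtain ⟨n, rfl⟩ : ∃ n, k = n + 1 := ⟨k - 1, by omega⟩
  have h : ((n : ℝ) + 1) * (3 - τ) < 2 := by
    rw [lt_div_iff₀ (by linarith)] at hkτ
    simpa using hkτ
  exact aux_main n d hd τ γ w₀ hτ hγ hw₀ h
end

section
/- Fix an integer k ≥ 3, an integer d ≥ 1, and reals τ ∈ (2,3), γ > 1. Suppose (α,β) is a maximizer of the clique exponent function f over the feasible region, i.e. f(α,β) ≥ f(α',β') for all feasible (α',β'). Then for every i ∈ {2,...,k} and all j₁, j₂ ∈ {1,...,d}, one has β_i^{(j₁)} = β_i^{(j₂)}. -/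
open MeasureTheory Real Finset
open scoped ENNReal Topology

/-- If `(α,β)` maximizes the clique exponent `f` over the feasible region, then for every
vertex `i ≥ 2` all coordinates of `β_i` coincide. -/
theorem maximizer_has_equal_beta_coordinates (k d : ℕ) (hk : 3 ≤ k) (hd : 1 ≤ d)
    (τ γ : ℝ) (hτ : 2 < τ) (hτ' : τ < 3) (hγ : 1 < γ)
    (α : Fin k → ℝ) (β : Fin k → Fin d → ℝ)
    (hα : ∀ i, 0 ≤ α i) (hβ : ∀ i : Fin k, (i : ℕ) ≠ 0 → ∀ h, β i h ≤ 0)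
    (hmax : ∀ (α' : Fin k → ℝ) (β' : Fin k → Fin d → ℝ),
      (∀ i, 0 ≤ α' i) → (∀ i : Fin k, (i : ℕ) ≠ 0 → ∀ h, β' i h ≤ 0) →
      cliqueExponent k d τ γ α' β' ≤ cliqueExponent k d τ γ α β) :
    ∀ i : Fin k, (i : ℕ) ≠ 0 → ∀ j₁ j₂ : Fin d, β i j₁ = β i j₂ := by
  intro i hi j₁ j₂
  haveI : Nonempty (Fin d) := ⟨j₁⟩
  have hbdd : ∀ g : Fin d → ℝ, BddAbove (Set.range g) := fun g => (Set.finite_range g).bddAbove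
  have hle : ∀ (i : Fin k) (h : Fin d), β i h ≤ ⨆ h, β i h := fun i h => le_ciSup (hbdd (β i)) h
  have hm := hmax α (fun i _ => ⨆ h, β i h) hα (fun i hi _ => ciSup_le (hβ i hi))
  have hpair : ∀ a b : Fin k, (⨆ h, max (β a h) (β b h)) = max (⨆ h, β a h) (⨆ h, β b h) := by
    intro a b
    apply le_antisymm
    · exact ciSup_le fun h => max_le_max (hle a h) (hle b h)
    · apply max_le
      · exact ciSup_mono (hbdd _) fun h => le_max_left _ _
      · exact ciSup_mono (hbdd _) fun h => le_max_right _ _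
  unfold cliqueExponent at hm
  simp only [ciSup_const, hpair] at hm
  have hs : ∑ i ∈ Finset.univ.filter (fun i : Fin k => (i : ℕ) ≠ 0), ∑ _h : Fin d, (⨆ h, β i h)
      ≤ ∑ i ∈ Finset.univ.filter (fun i : Fin k => (i : ℕ) ≠ 0), ∑ h, β i h := by
    linarith
  have key : ∀ j, β i j = ⨆ h, β i h := by
    by_contra hne
    obtain ⟨j, hj⟩ := not_forall.mp hne
    refine absurd hs (not_le.mpr ?_)
    apply Finset.sum_lt_sum
    · exact fun a _ => Finset.sum_le_sum fun h _ => hle a h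
    · exact ⟨i, by simpa using hi, Finset.sum_lt_sum (fun h _ => hle i h)
        ⟨j, Finset.mem_univ j, lt_of_le_of_ne (hle i j) hj⟩⟩
  rw [key j₁, key j₂]
end

section
/- Fix an integer k ≥ 3, an integer d ≥ 1, and reals τ ∈ (2,3), γ > 1. Suppose (α, β) with α = (α₁,...,α_k), β = (β₂,...,β_k) is a maximizer of the scalar clique exponent function f̃ over the scalar feasible region, i.e. f̃(α,β) ≥ f̃(α',β') for all feasible (α',β'). Then β_i ≥ −1/d for every i ∈ {2,...,k}. -/
open MeasureTheory Real Finset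
open scoped ENNReal Topology

/-- The scalar clique exponent function `f̃(α,β)` from the paper, with the convention
`β₁ = -∞` (here index `0`), so that for pairs with `i = 0` the maximum equals `β j`.
The value `β 0` is irrelevant. -/
noncomputable def cliqueExponentScalar (k d : ℕ) (τ γ : ℝ)
    (α : Fin k → ℝ) (β : Fin k → ℝ) : ℝ :=
  k + (1 - τ) * ∑ i, α i
    + d * ∑ i ∈ Finset.univ.filter (fun i : Fin k => (i : ℕ) ≠ 0), β i
    + ∑ i : Fin k, ∑ j ∈ Finset.Ioi i,
        γ * min (α i + α j - 1 -
          d * (if (i : ℕ) = 0 then β j else max (β i) (β j))) 0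

/-- At a maximizer of the scalar clique exponent over the feasible region,
no coordinate `β i` (for `i ≥ 2`) lies below `-1/d`. -/
theorem maximizer_beta_lower_bound (k d : ℕ) (hk : 3 ≤ k) (hd : 1 ≤ d)
    (τ γ : ℝ) (hτ : 2 < τ) (hτ' : τ < 3) (hγ : 1 < γ)
    (α : Fin k → ℝ) (β : Fin k → ℝ)
    (hα : ∀ i, 0 ≤ α i) (hβ : ∀ i : Fin k, (i : ℕ) ≠ 0 → β i ≤ 0)
    (hmax : ∀ (α' : Fin k → ℝ) (β' : Fin k → ℝ),
      (∀ i, 0 ≤ α' i) → (∀ i : Fin k, (i : ℕ) ≠ 0 → β' i ≤ 0) →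
      cliqueExponentScalar k d τ γ α' β' ≤ cliqueExponentScalar k d τ γ α β) :
    ∀ i : Fin k, (i : ℕ) ≠ 0 → -(1 / (d : ℝ)) ≤ β i := by
  intro i₀ hi₀
  by_contra hlt
  push Not at hlt
  have hd0 : (0 : ℝ) < d := by exact_mod_cast hd
  have hdc : (d : ℝ) * -(1 / (d : ℝ)) = -1 := by field_simp
  have hc0 : -(1 / (d : ℝ)) ≤ 0 := by
    have : 0 < 1 / (d : ℝ) := by positivity
    linarith
  generalize -(1 / (d : ℝ)) = c at hlt hdc hc0
  have key : ∀ a x : ℝ, 0 ≤ a →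
      min (a - 1 - d * x) 0 ≤ min (a - 1 - d * max x c) 0 := by
    intro a x ha
    rcases le_total c x with h | h
    · rw [max_eq_left h]
    · rw [max_eq_right h, hdc]
      exact (min_le_right _ _).trans (le_min (by linarith) le_rfl)
  have h := hmax α (fun i => max (β i) c) hα (fun i hi => max_le (hβ i hi) hc0)
  unfold cliqueExponentScalar at h
  have h1 : ∑ i ∈ Finset.univ.filter (fun i : Fin k => (i : ℕ) ≠ 0), β i
      < ∑ i ∈ Finset.univ.filter (fun i : Fin k => (i : ℕ) ≠ 0), max (β i) c := by
    apply Finset.sum_lt_sum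
    · intro i _
      exact le_max_left _ _
    · exact ⟨i₀, by simpa using hi₀, lt_max_of_lt_right hlt⟩
  have h2 : ∑ i : Fin k, ∑ j ∈ Finset.Ioi i,
        γ * min (α i + α j - 1 -
          d * (if (i : ℕ) = 0 then β j else max (β i) (β j))) 0
      ≤ ∑ i : Fin k, ∑ j ∈ Finset.Ioi i,
        γ * min (α i + α j - 1 -
          d * (if (i : ℕ) = 0 then max (β j) c else max (max (β i) c) (max (β j) c))) 0 := by
    refine Finset.sum_le_sum fun i _ => Finset.sum_le_sum fun j _ => ?_
    apply mul_le_mul_of_nonneg_left _ (by linarith)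
    have ha := add_nonneg (hα i) (hα j)
    split_ifs
    · exact key _ _ ha
    · rw [← max_max_max_comm, max_self]
      exact key _ _ ha
  have h3 := mul_lt_mul_of_pos_left h1 hd0
  linarith
end

section
/- Fix an integer k ≥ 3, an integer d ≥ 1, and reals τ ∈ (2,3), γ > 1. Suppose (α, β) with α = (α₁,...,α_k), β = (β₂,...,β_k) is a maximizer of the scalar clique exponent function f̃ over the scalar feasible region. If β_i = −1/d for some i ∈ {2,...,k}, then α_i = 0. -/
open MeasureTheory Real Finset
open scoped ENNReal Topology

/-- At a maximizer of the scalar clique exponent over the feasible region,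
if `β i = -1/d` for some `i ≥ 2`, then `α i = 0`. -/
theorem maximizer_alpha_zero_of_beta_min (k d : ℕ) (hk : 3 ≤ k) (hd : 1 ≤ d)
    (τ γ : ℝ) (hτ : 2 < τ) (hτ' : τ < 3) (hγ : 1 < γ)
    (α : Fin k → ℝ) (β : Fin k → ℝ)
    (hα : ∀ i, 0 ≤ α i) (hβ : ∀ i : Fin k, (i : ℕ) ≠ 0 → β i ≤ 0)
    (hmax : ∀ (α' : Fin k → ℝ) (β' : Fin k → ℝ),
      (∀ i, 0 ≤ α' i) → (∀ i : Fin k, (i : ℕ) ≠ 0 → β' i ≤ 0) →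
      cliqueExponentScalar k d τ γ α' β' ≤ cliqueExponentScalar k d τ γ α β) :
    ∀ i : Fin k, (i : ℕ) ≠ 0 → β i = -(1 / (d : ℝ)) → α i = 0 := by
  intro i hi hbi
  by_contra hne
  have hai : 0 < α i := lt_of_le_of_ne (hα i) (Ne.symm hne)
  have hd0 : (0 : ℝ) < d := by exact_mod_cast hd
  have hdb : (d : ℝ) * β i = -1 := by rw [hbi]; field_simp
  -- a small admissible increase of `β i`
  have hev : ∀ᶠ ε : ℝ in 𝓝[>] (0 : ℝ), ∀ j, β i < β j → ε < β j - β i := by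
    rw [Filter.eventually_all]
    intro j
    by_cases h : β i < β j
    · filter_upwards [Ioo_mem_nhdsGT (sub_pos.mpr h)] with ε hε _ using hε.2
    · exact Filter.Eventually.of_forall fun ε h' => absurd h' h
  have hev2 : ∀ᶠ ε : ℝ in 𝓝[>] (0 : ℝ), 0 < ε ∧ ε < 1 / d := by
    filter_upwards [Ioo_mem_nhdsGT (show (0 : ℝ) < 1 / d by positivity)] with ε hε using hε
  have hev3 : ∀ᶠ ε : ℝ in 𝓝[>] (0 : ℝ), ε < α i / d := by
    filter_upwards [Ioo_mem_nhdsGT (show (0 : ℝ) < α i / d by positivity)] with ε hε using hε.2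
  obtain ⟨ε, h1, ⟨h0, h2⟩, h3⟩ := (hev.and (hev2.and hev3)).exists
  rw [lt_div_iff₀ hd0] at h3
  -- the key slack estimate for an edge at `i`
  have key : ∀ j, 0 ≤ α i + α j - 1 - d * (β i + ε) := by
    intro j
    have := hα j
    nlinarith
  have keymax : ∀ j, min (α i + α j - 1 - d * max (β i) (β j)) 0
      ≤ min (α i + α j - 1 - d * max (β i + ε) (β j)) 0 := by
    intro j
    by_cases h : β i < β j
    · have := h1 j h
      rw [max_eq_right h.le, max_eq_right (by linarith)]
    · rw [max_eq_left (a := β i + ε) (by linarith)]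
      rw [min_eq_right (key j)]
      exact min_le_right _ _
  have hm := hmax α (Function.update β i (β i + ε)) hα (by
    intro j hj
    by_cases h : j = i
    · subst h
      rw [Function.update_self]
      linarith
    · rw [Function.update_of_ne h]
      exact hβ j hj)
  refine absurd hm (not_le.mpr ?_)
  unfold cliqueExponentScalar
  refine add_lt_add_of_lt_of_le ?_ ?_
  · refine add_lt_add_of_le_of_lt le_rfl (mul_lt_mul_of_pos_left ?_ hd0)
    refine Finset.sum_lt_sum ?_ ⟨i, by simpa using hi, by simpa using h0⟩
    intro j _
    by_cases h : j = i
    · subst h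
      rw [Function.update_self]
      linarith
    · rw [Function.update_of_ne h]
  · refine Finset.sum_le_sum fun p _ => Finset.sum_le_sum fun q hq => ?_
    refine mul_le_mul_of_nonneg_left ?_ (by linarith)
    have hpq : p < q := Finset.mem_Ioi.mp hq
    by_cases hp : p = i
    · subst hp
      rw [if_neg hi, if_neg hi, Function.update_self, Function.update_of_ne hpq.ne']
      exact keymax q
    · rw [Function.update_of_ne hp]
      by_cases hqi : q = i
      · subst hqi
        rw [Function.update_self, add_comm (α p)]
        by_cases hp0 : (p : ℕ) = 0
        · rw [if_pos hp0, if_pos hp0, min_eq_right (key p)]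
          exact min_le_right _ _
        · rw [if_neg hp0, if_neg hp0, max_comm (β p), max_comm (β p)]
          exact keymax p
      · rw [Function.update_of_ne hqi]
end

section
/- Fix an integer k ≥ 3, an integer d ≥ 1, and reals τ ∈ (2,3), γ > 1. Suppose (α, β) with α = (α₁,...,α_k), β = (β₂,...,β_k) is a maximizer of the scalar clique exponent function f̃ over the scalar feasible region. Then for all i, j ∈ {2,...,k}, if β_i < β_j then α_i ≤ α_j. -/
open MeasureTheory Real Finset
open scoped ENNReal Topology

/-- The pair interaction term. -/
noncomputable def pairTerm (k d : ℕ) (α β : Fin k → ℝ) (i j : Fin k) : ℝ :=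
  min (α i + α j - 1 - d * (if (i : ℕ) = 0 then β j else max (β i) (β j))) 0

/-- Change of one `β` coordinate by `δ`. -/
lemma diff_formula (k d : ℕ) (τ γ : ℝ) (α β : Fin k → ℝ) (m : Fin k) (hm : (m : ℕ) ≠ 0) (δ : ℝ) :
    cliqueExponentScalar k d τ γ α (Function.update β m (β m + δ))
      - cliqueExponentScalar k d τ γ α β = d * δ + γ * ∑ i : Fin k, ∑ j ∈ Finset.Ioi i,
        (pairTerm k d α (Function.update β m (β m + δ)) i j - pairTerm k d α β i j) := by
  have h1 : ∑ i ∈ Finset.univ.filter (fun i : Fin k => (i : ℕ) ≠ 0),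
      Function.update β m (β m + δ) i
      = ∑ i ∈ Finset.univ.filter (fun i : Fin k => (i : ℕ) ≠ 0), β i + δ := by
    have : ∀ i, Function.update β m (β m + δ) i = β i + if i = m then δ else 0 := by
      intro i
      by_cases h : i = m
      · subst h; simp
      · simp [h]
    simp only [this, Finset.sum_add_distrib]
    rw [Finset.sum_ite_eq']
    simp [hm]
  unfold cliqueExponentScalar
  rw [h1]
  simp only [Finset.sum_sub_distrib, ← Finset.mul_sum, pairTerm]
  ring

lemma cond_A (k d : ℕ) (hd : 1 ≤ d) (τ γ : ℝ) (hγ : 1 < γ) (α β : Fin k → ℝ)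
    (hα : ∀ i, 0 ≤ α i) (hβ : ∀ i : Fin k, (i : ℕ) ≠ 0 → β i ≤ 0)
    (hmax : ∀ (α' : Fin k → ℝ) (β' : Fin k → ℝ),
      (∀ i, 0 ≤ α' i) → (∀ i : Fin k, (i : ℕ) ≠ 0 → β' i ≤ 0) →
      cliqueExponentScalar k d τ γ α' β' ≤ cliqueExponentScalar k d τ γ α β)
    (m l : Fin k) (hm : (m : ℕ) ≠ 0) (hl : l ≠ m) (hlm : (l : ℕ) = 0 ∨ β l < β m) :
    0 ≤ α m + α l - 1 - d * β m := by
  by_contra! ht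
  have hd0 : (0 : ℝ) < d := by exact_mod_cast hd
  obtain ⟨ε, hε, h1, h2⟩ : ∃ ε : ℝ, 0 < ε ∧ α m + α l - 1 - d * β m + d * ε ≤ 0 ∧
      ((l : ℕ) = 0 ∨ β l ≤ β m - ε) := by
    have hp : 0 < -(α m + α l - 1 - d * β m) / d := div_pos (by linarith) hd0
    have key : ∀ ε, ε ≤ -(α m + α l - 1 - d * β m) / d →
        α m + α l - 1 - d * β m + d * ε ≤ 0 := by
      intro ε h
      rw [le_div_iff₀ hd0] at h
      linarith
    rcases hlm with h | h
    · exact ⟨_, hp, key _ le_rfl, Or.inl h⟩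
    · refine ⟨min (-(α m + α l - 1 - d * β m) / d) (β m - β l), lt_min hp (by linarith),
        key _ (min_le_left _ _), Or.inr ?_⟩
      have := min_le_right (-(α m + α l - 1 - d * β m) / d) (β m - β l)
      linarith
  have hf := diff_formula k d τ γ α β m hm (-ε)
  set β' := Function.update β m (β m + -ε) with hβ'
  have hm' : β' m = β m - ε := by simp [hβ']; ring
  have hne : ∀ i, i ≠ m → β' i = β i := fun i h => by simp [hβ', h]
  have hle : ∀ i, β' i ≤ β i := by
    intro i
    by_cases h : i = m
    · subst h; linarith
    · exact (hne i h).le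
  have hx := hmax α β' hα (fun i hi => (hle i).trans (hβ i hi))
  have hnn : ∀ i j, 0 ≤ pairTerm k d α β' i j - pairTerm k d α β i j := by
    intro i j
    unfold pairTerm
    rw [sub_nonneg]
    refine min_le_min ?_ le_rfl
    have : (if (i : ℕ) = 0 then β' j else max (β' i) (β' j))
        ≤ (if (i : ℕ) = 0 then β j else max (β i) (β j)) := by
      split_ifs
      · exact hle j
      · exact max_le_max (hle i) (hle j)
    have := mul_le_mul_of_nonneg_left this hd0.le
    linarith
  have hbig : ∀ i j, i < j → d * ε ≤ pairTerm k d α β' i j - pairTerm k d α β i j →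
      d * ε ≤ ∑ i : Fin k, ∑ j ∈ Finset.Ioi i,
        (pairTerm k d α β' i j - pairTerm k d α β i j) := by
    intro i j hij h
    refine h.trans ?_
    refine (Finset.single_le_sum (f := fun j => pairTerm k d α β' i j - pairTerm k d α β i j)
      (fun j _ => hnn i j) (Finset.mem_Ioi.2 hij)).trans ?_
    exact Finset.single_le_sum (f := fun i => ∑ j ∈ Finset.Ioi i,
        (pairTerm k d α β' i j - pairTerm k d α β i j))
      (fun i _ => Finset.sum_nonneg fun j _ => hnn i j) (Finset.mem_univ i)
  have hS : d * ε ≤ ∑ i : Fin k, ∑ j ∈ Finset.Ioi i,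
        (pairTerm k d α β' i j - pairTerm k d α β i j) := by
    rcases lt_or_gt_of_ne hl with h | h
    · apply hbig l m h
      have e1 : (if (l : ℕ) = 0 then β m else max (β l) (β m)) = β m := by
        split_ifs with h0
        · rfl
        · rcases h2 with h2 | h2
          · exact absurd h2 h0
          · exact max_eq_right (by linarith)
      have e2 : (if (l : ℕ) = 0 then β m - ε else max (β l) (β m - ε)) = β m - ε := by
        split_ifs with h0
        · rfl
        · rcases h2 with h2 | h2
          · exact absurd h2 h0
          · exact max_eq_right (by linarith)
      unfold pairTerm
      rw [hne l hl, hm', e1, e2, min_eq_left (by linarith), min_eq_left (by linarith)]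
      linarith
    · apply hbig m l h
      have h0 : (l : ℕ) ≠ 0 := by have : (m : ℕ) < l := h; omega
      have h2 := h2.resolve_left h0
      unfold pairTerm
      rw [hne l hl, hm', if_neg hm, if_neg hm, max_eq_left (by linarith),
        max_eq_left (by linarith), min_eq_left (by linarith), min_eq_left (by linarith)]
      linarith
  have hde : 0 < d * ε := by positivity
  nlinarith

lemma cond_B (k d : ℕ) (hd : 1 ≤ d) (τ γ : ℝ) (α β : Fin k → ℝ)
    (hα : ∀ i, 0 ≤ α i) (hβ : ∀ i : Fin k, (i : ℕ) ≠ 0 → β i ≤ 0)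
    (hmax : ∀ (α' : Fin k → ℝ) (β' : Fin k → ℝ),
      (∀ i, 0 ≤ α' i) → (∀ i : Fin k, (i : ℕ) ≠ 0 → β' i ≤ 0) →
      cliqueExponentScalar k d τ γ α' β' ≤ cliqueExponentScalar k d τ γ α β)
    (m : Fin k) (hm : (m : ℕ) ≠ 0) (hneg : β m < 0) :
    ∃ l, l ≠ m ∧ ((l : ℕ) = 0 ∨ β l ≤ β m) ∧ α m + α l - 1 - d * β m ≤ 0 := by
  by_contra! ht
  have hd0 : (0 : ℝ) < d := by exact_mod_cast hd
  have hlt : ∀ c : ℝ, 0 < c → ∀ᶠ ε in 𝓝[>] (0 : ℝ), ε < c := fun c hc =>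
    eventually_nhdsWithin_of_eventually_nhds (eventually_lt_nhds hc)
  have hall : ∀ᶠ ε in 𝓝[>] (0 : ℝ), ∀ l, l ≠ m →
      (0 ≤ α m + α l - 1 - d * (β m + ε) ∧ ((l : ℕ) = 0 ∨ β l ≤ β m)) ∨
        ((l : ℕ) ≠ 0 ∧ β m + ε ≤ β l) := by
    rw [Filter.eventually_all]
    intro l
    by_cases hl : l = m
    · simp [hl]
    by_cases hc : (l : ℕ) = 0 ∨ β l ≤ β m
    · have h := ht l hl hc
      filter_upwards [hlt _ (div_pos h hd0)] with ε he _
      rw [lt_div_iff₀ hd0] at he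
      exact Or.inl ⟨by linarith, hc⟩
    · have hc' := hc
      push Not at hc'
      filter_upwards [hlt (β l - β m) (by linarith)] with ε he _
      exact Or.inr ⟨hc'.1, by linarith⟩
  obtain ⟨ε, hε, h0, hε0⟩ :=
    (hall.and ((hlt (-β m) (by linarith)).and self_mem_nhdsWithin)).exists
  have hε0 : 0 < ε := hε0
  have hf := diff_formula k d τ γ α β m hm ε
  set β' := Function.update β m (β m + ε) with hβ'
  have hm' : β' m = β m + ε := by simp [hβ']
  have hne : ∀ i, i ≠ m → β' i = β i := fun i h => by simp [hβ', h]
  have hx := hmax α β' hα (fun i hi => by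
    by_cases h : i = m
    · subst h; linarith
    · rw [hne i h]; exact hβ i hi)
  have hde : 0 < d * ε := by positivity
  have hz : ∑ i : Fin k, ∑ j ∈ Finset.Ioi i,
        (pairTerm k d α β' i j - pairTerm k d α β i j) = 0 := by
    refine Finset.sum_eq_zero fun i _ => Finset.sum_eq_zero fun j hj => ?_
    have hij : i < j := Finset.mem_Ioi.1 hj
    have hj0 : (j : ℕ) ≠ 0 := by have : (i : ℕ) < j := hij; omega
    unfold pairTerm
    by_cases him : i = m
    · subst him
      have hji : j ≠ i := hij.ne'
      rw [hne j hji, hm', if_neg hm, if_neg hm]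
      rcases hε j hji with ⟨h1, h2⟩ | ⟨h1, h2⟩
      · have h2 := h2.resolve_left hj0
        rw [max_eq_left (by linarith), max_eq_left (by linarith), min_eq_right (by linarith),
          min_eq_right (by linarith), sub_self]
      · rw [max_eq_right (by linarith), max_eq_right (by linarith), sub_self]
    by_cases hjm : j = m
    · subst hjm
      rw [hne i him, hm']
      rcases hε i him with ⟨h1, h2⟩ | ⟨h1, h2⟩
      · have e1 : (if (i : ℕ) = 0 then β j else max (β i) (β j)) = β j := by
          split_ifs with h0
          · rfl
          · exact max_eq_right (h2.resolve_left h0)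
        have e2 : (if (i : ℕ) = 0 then β j + ε else max (β i) (β j + ε)) = β j + ε := by
          split_ifs with h0
          · rfl
          · exact max_eq_right (by have := h2.resolve_left h0; linarith)
        rw [e1, e2, min_eq_right (by linarith), min_eq_right (by linarith), sub_self]
      · rw [if_neg h1, if_neg h1, max_eq_left (by linarith), max_eq_left (by linarith), sub_self]
    rw [hne i him, hne j hjm, sub_self]
  rw [hz] at hf
  linarith

/-- At a maximizer of the scalar clique exponent over the feasible region, the
`α` and `β` values (for indices `≥ 2`) are similarly ordered: `β i < β j → α i ≤ α j`. -/
theorem maximizer_joint_ordering (k d : ℕ) (hk : 3 ≤ k) (hd : 1 ≤ d)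
    (τ γ : ℝ) (hτ : 2 < τ) (hτ' : τ < 3) (hγ : 1 < γ)
    (α : Fin k → ℝ) (β : Fin k → ℝ)
    (hα : ∀ i, 0 ≤ α i) (hβ : ∀ i : Fin k, (i : ℕ) ≠ 0 → β i ≤ 0)
    (hmax : ∀ (α' : Fin k → ℝ) (β' : Fin k → ℝ),
      (∀ i, 0 ≤ α' i) → (∀ i : Fin k, (i : ℕ) ≠ 0 → β' i ≤ 0) →
      cliqueExponentScalar k d τ γ α' β' ≤ cliqueExponentScalar k d τ γ α β) :
    ∀ i j : Fin k, (i : ℕ) ≠ 0 → (j : ℕ) ≠ 0 → β i < β j → α i ≤ α j := by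
  intro i j hi hj hij
  by_contra! hc
  have hneg : β i < 0 := lt_of_lt_of_le hij (hβ j hj)
  obtain ⟨l, hli, h1, h2⟩ := cond_B k d hd τ γ α β hα hβ hmax i hi hneg
  have hd0 : (0 : ℝ) < d := by exact_mod_cast hd
  have hlj : l ≠ j := by
    rintro rfl
    rcases h1 with h1 | h1
    · exact hj h1
    · linarith
  have hA := cond_A k d hd τ γ hγ α β hα hβ hmax j l hj hlj
    (h1.imp id (fun h => lt_of_le_of_lt h hij))
  have := mul_lt_mul_of_pos_left hij hd0
  linarith
end
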